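/- Let n ≥ 2, let U and V be domains (nonempty open connected sets) in ℝ^n, and let f : U → V be a homeomorphism that is H-quasiconformal, i.e., whose linear dilatation satisfies H_f(x) ≤ H for every x ∈ U, where H_f(x) = limsup_{r → 0} ( sup{ |f(x) − f(y)| : |x − y| ≤ r } / inf{ |f(x) − f(y)| : |x − y| ≥ r } ). Then for every compact subset A ⊆ U, the restriction f|_A : A → f(A) is an η-quasisymmetry for some distortion function η (which can be chosen depending only on H, n and A). -/

import Mathlib

open MeasureTheory
open scoped ENNReal

noncomputable section

/-- A distortion function `η : [0,∞) → [0,∞)` for quasisymmetric maps: increasing,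
continuous, `η 0 = 0` and `η t → ∞` as `t → ∞`. -/
structure IsDistortion (η : ℝ → ℝ) : Prop where
  continuousOn : ContinuousOn η (Set.Ici 0)
  monotoneOn : MonotoneOn η (Set.Ici 0)
  nonneg : ∀ t : ℝ, 0 ≤ t → 0 ≤ η t
  map_zero : η 0 = 0
  tendsto_atTop : Filter.Tendsto η Filter.atTop Filter.atTop

/-- The linear dilatation of `f` at `x`, computed within the set `U`:
`H_f(x) = limsup_{r → 0⁺} (sup{d(f x, f y) : y ∈ U, d(x,y) ≤ r} /
inf{d(f x, f y) : y ∈ U, d(x,y) ≥ r})`, valued in `ℝ≥0∞`. -/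
def linearDilatationOn {X Y : Type*} [MetricSpace X] [MetricSpace Y]
    (f : X → Y) (U : Set X) (x : X) : ℝ≥0∞ :=
  Filter.limsup
    (fun r : ℝ =>
      (⨆ y ∈ {y ∈ U | dist x y ≤ r}, edist (f x) (f y)) /
        (⨅ y ∈ {y ∈ U | r ≤ dist x y}, edist (f x) (f y)))
    (nhdsWithin 0 (Set.Ioi 0))

section Auxiliary

open Metric Module

open Classical in
/-- If a preconnected set is covered by finitely many pieces on each of which `φ` oscillates by at
most `d i`, then `φ` varies by at most the sum of the `d i` over the pieces that are met. -/
theorem IsPreconnected.abs_sub_le_sum_osc {X ι : Type*} [TopologicalSpace X] {S : Set X}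
    (hS : IsPreconnected S) {φ : X → ℝ} (hφ : ContinuousOn φ S) (I : Finset ι) (T : ι → Set X)
    (hcov : S ⊆ ⋃ i ∈ I, T i) (d : ι → ℝ) (hd0 : ∀ i ∈ I, 0 ≤ d i)
    (hd : ∀ i ∈ I, ∀ p ∈ S ∩ T i, ∀ q ∈ S ∩ T i, |φ p - φ q| ≤ d i)
    {x y : X} (hx : x ∈ S) (hy : y ∈ S) :
    |φ x - φ y| ≤ ∑ i ∈ I, if (S ∩ T i).Nonempty then d i else 0 := by
  have hpos : ∀ i ∈ I, 0 ≤ if (S ∩ T i).Nonempty then d i else 0 := by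
    intro i hi
    split_ifs
    exacts [hd0 i hi, le_rfl]
  have h1 : Set.uIcc (φ y) (φ x) ⊆ ⋃ i ∈ I, φ '' (S ∩ T i) := by
    refine ((hS.image φ hφ).ordConnected.uIcc_subset ⟨y, hy, rfl⟩ ⟨x, hx, rfl⟩).trans ?_
    rintro _ ⟨p, hp, rfl⟩
    obtain ⟨i, hi, hpi⟩ := Set.mem_iUnion₂.1 (hcov hp)
    exact Set.mem_iUnion₂.2 ⟨i, hi, p, ⟨hp, hpi⟩, rfl⟩
  have h2 : ENNReal.ofReal |φ x - φ y| ≤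
      ENNReal.ofReal (∑ i ∈ I, if (S ∩ T i).Nonempty then d i else 0) := by
    rw [← Real.volume_interval, ENNReal.ofReal_sum_of_nonneg hpos]
    refine (measure_mono h1).trans ((measure_biUnion_finset_le _ _).trans ?_)
    refine Finset.sum_le_sum fun i hi => ?_
    split_ifs with h
    · refine (Real.volume_le_diam _).trans (Metric.ediam_le ?_)
      rintro _ ⟨p, hp, rfl⟩ _ ⟨q, hq, rfl⟩
      rw [edist_dist, Real.dist_eq]
      exact ENNReal.ofReal_le_ofReal (hd i hi p hp q hq)
    · simp [Set.not_nonempty_iff_eq_empty.1 h]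
  exact (ENNReal.ofReal_le_ofReal_iff (Finset.sum_nonneg hpos)).1 h2

section Haar

variable {E : Type*} [NormedAddCommGroup E] [NormedSpace ℝ E] [FiniteDimensional ℝ E]
  [MeasurableSpace E] [BorelSpace E] (μ : Measure E) [μ.IsAddHaarMeasure]

/-- Volume of a tubular neighbourhood of a segment. -/
theorem addHaar_segment_tube_le [Nontrivial E] (x v : E) {σ : ℝ} (hσ : 0 < σ) :
    μ {y | ∃ s ∈ Set.Icc (0 : ℝ) 1, ‖y - x - s • v‖ ≤ σ} ≤
      ENNReal.ofReal ((‖v‖ / σ + 2) * (2 * σ) ^ finrank ℝ E) * μ (ball 0 1) := by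
  set m : ℕ := ⌊‖v‖ / σ⌋₊ + 1 with hm
  have hm0 : (0 : ℝ) < m := by positivity
  have hvm : ‖v‖ / m ≤ σ := by
    rw [div_le_iff₀ hm0]
    have := Nat.lt_floor_add_one (‖v‖ / σ)
    rw [div_lt_iff₀ hσ] at this
    push_cast [hm]
    linarith
  have hsub : {y | ∃ s ∈ Set.Icc (0 : ℝ) 1, ‖y - x - s • v‖ ≤ σ} ⊆
      ⋃ k ∈ Finset.range (m + 1), closedBall (x + ((k : ℝ) / m) • v) (2 * σ) := by
    rintro y ⟨s, ⟨hs0, hs1⟩, hy⟩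
    refine Set.mem_iUnion₂.2 ⟨⌊s * m⌋₊, ?_, ?_⟩
    · rw [Finset.mem_range, Nat.lt_succ_iff]
      exact Nat.floor_le_of_le (by nlinarith)
    · have h1 := Nat.floor_le (show 0 ≤ s * m by positivity)
      have h2 := Nat.lt_floor_add_one (s * m)
      set k : ℝ := (⌊s * m⌋₊ : ℝ)
      have h3 : ‖(s - k / m) • v‖ ≤ σ := by
        rw [norm_smul, Real.norm_eq_abs]
        have : |s - k / m| ≤ 1 / m := by
          rw [abs_of_nonneg]
          · rw [sub_le_iff_le_add, ← add_div, le_div_iff₀ hm0]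
            linarith
          · rw [sub_nonneg, div_le_iff₀ hm0]
            exact h1
        calc |s - k / m| * ‖v‖ ≤ 1 / m * ‖v‖ := by gcongr
          _ = ‖v‖ / m := by ring
          _ ≤ σ := hvm
      rw [mem_closedBall, dist_eq_norm]
      calc ‖y - (x + (k / m) • v)‖ = ‖(y - x - s • v) + (s - k / m) • v‖ := by
            congr 1; module
        _ ≤ σ + σ := (norm_add_le _ _).trans (add_le_add hy h3)
        _ = 2 * σ := by ring
  refine (measure_mono hsub).trans ((measure_biUnion_finset_le _ _).trans ?_)
  simp_rw [Measure.addHaar_closedBall μ _ (by positivity : 0 ≤ 2 * σ)]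
  rw [Finset.sum_const, Finset.card_range, nsmul_eq_mul, ← mul_assoc]
  gcongr
  rw [← ENNReal.ofReal_natCast, ← ENNReal.ofReal_mul (by positivity)]
  refine ENNReal.ofReal_le_ofReal ?_
  gcongr
  have := Nat.floor_le (show 0 ≤ ‖v‖ / σ by positivity)
  push_cast [hm]
  linarith

/-- Volume of the shadow cast inside a ball around `x` by a small ball, as seen from `x`. -/
theorem addHaar_shadow_le [Nontrivial E] (x c : E) {ρ R : ℝ} (hρ : 0 < ρ) (hR : 0 < R) :
    μ {y | y ∈ closedBall x R ∧ (segment ℝ x y ∩ ball c ρ).Nonempty} ≤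
      ENNReal.ofReal (4 * 6 ^ finrank ℝ E * R ^ finrank ℝ E *
        (ρ / (‖c - x‖ + ρ)) ^ (finrank ℝ E - 1)) * μ (ball 0 1) := by
  obtain ⟨k, hk⟩ : ∃ k, finrank ℝ E = k + 1 := Nat.exists_eq_succ_of_ne_zero finrank_pos.ne'
  have hk' : finrank ℝ E - 1 = k := by omega
  rw [hk']
  set h := ‖c - x‖ with hh
  have hh0 : 0 ≤ h := norm_nonneg _
  by_cases hc : h ≤ 2 * ρ
  · refine (measure_mono (fun y hy => hy.1)).trans ?_
    rw [Measure.addHaar_closedBall μ _ hR.le, hk]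
    gcongr
    have h1 : (1 : ℝ) / 3 ≤ ρ / (h + ρ) := by
      rw [div_le_div_iff₀ (by norm_num) (by positivity)]; linarith
    have h2 : (1 / 3 : ℝ) ^ k ≤ (ρ / (h + ρ)) ^ k := by gcongr
    have h3 : (1 : ℝ) ≤ 4 * 6 ^ (k + 1) * (1 / 3) ^ k := by
      rw [pow_succ, show (4 * (6 ^ k * 6) * (1 / 3) ^ k : ℝ) = 24 * (6 ^ k * (1 / 3) ^ k) by ring,
        ← mul_pow]
      have : (1 : ℝ) ≤ (6 * (1 / 3)) ^ k := one_le_pow₀ (by norm_num)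
      linarith
    calc R ^ (k + 1) = 1 * R ^ (k + 1) := by ring
      _ ≤ (4 * 6 ^ (k + 1) * (1 / 3) ^ k) * R ^ (k + 1) := by gcongr
      _ = 4 * 6 ^ (k + 1) * R ^ (k + 1) * (1 / 3) ^ k := by ring
      _ ≤ _ := by gcongr
  · push Not at hc
    have hhp : 0 < h := by linarith
    have hσ : 0 < 2 * R * ρ / h := by positivity
    have hsub : {y | y ∈ closedBall x R ∧ (segment ℝ x y ∩ ball c ρ).Nonempty} ⊆
        {y | ∃ s ∈ Set.Icc (0 : ℝ) 1,
          ‖y - x - s • ((2 * R / h) • (c - x))‖ ≤ 2 * R * ρ / h} := by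
      rintro y ⟨hy, w, hw, hwc⟩
      rw [segment_eq_image'] at hw
      obtain ⟨τ, ⟨hτ0, hτ1⟩, rfl⟩ := hw
      rw [mem_closedBall, dist_eq_norm] at hy
      rw [mem_ball, dist_eq_norm] at hwc
      have h1 : h - ρ < τ * ‖y - x‖ := by
        have : ‖c - x‖ ≤ ‖x + τ • (y - x) - c‖ + ‖τ • (y - x)‖ := by
          rw [← norm_neg (x + τ • (y - x) - c)]
          refine le_trans (le_of_eq ?_) (norm_add_le _ _)
          congr 1; module
        rw [norm_smul, Real.norm_eq_abs, abs_of_nonneg hτ0] at this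
        linarith
      have h2 : h / 2 < τ * R := by nlinarith
      have hτ : 0 < τ := by
        by_contra hcon
        have : τ = 0 := le_antisymm (not_lt.1 hcon) hτ0
        rw [this] at h2; linarith
      refine ⟨h / (2 * R * τ), ⟨by positivity, ?_⟩, ?_⟩
      · rw [div_le_one (by positivity)]; linarith
      · have h3 : y - x - (h / (2 * R * τ)) • ((2 * R / h) • (c - x)) =
            τ⁻¹ • (x + τ • (y - x) - c) := by
          rw [smul_smul, show h / (2 * R * τ) * (2 * R / h) = τ⁻¹ by field_simp]
          rw [show x + τ • (y - x) - c = τ • (y - x) - (c - x) by module,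
            smul_sub τ⁻¹ (τ • (y - x)) (c - x), smul_smul τ⁻¹ τ,
            inv_mul_cancel₀ hτ.ne', one_smul]
        rw [h3, norm_smul, Real.norm_eq_abs, abs_of_pos (by positivity)]
        calc τ⁻¹ * ‖x + τ • (y - x) - c‖ ≤ (2 * R / h) * ρ := by
              gcongr
              rw [inv_le_comm₀ hτ (by positivity), inv_div, div_le_iff₀ (by positivity)]
              linarith
          _ = _ := by ring
    refine (measure_mono hsub).trans ((addHaar_segment_tube_le μ x _ hσ).trans ?_)
    rw [hk]
    have hv : ‖(2 * R / h) • (c - x)‖ = 2 * R := by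
      rw [norm_smul, Real.norm_eq_abs, abs_of_pos (by positivity), ← hh]
      field_simp
    rw [hv, show 2 * R / (2 * R * ρ / h) = h / ρ by field_simp]
    have h1 : h / ρ + 2 ≤ 2 * (h / ρ) := by
      have : 2 ≤ h / ρ := by rw [le_div_iff₀ hρ]; exact hc.le
      linarith
    have h2 : ρ / h ≤ 3 / 2 * (ρ / (h + ρ)) := by
      rw [← mul_div_assoc, div_le_div_iff₀ hhp (by positivity)]; nlinarith
    refine mul_le_mul_left (ENNReal.ofReal_le_ofReal ?_) _
    calc (h / ρ + 2) * (2 * (2 * R * ρ / h)) ^ (k + 1)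
        ≤ 2 * (h / ρ) * (2 * (2 * R * ρ / h)) ^ (k + 1) := by gcongr
      _ = 2 * 4 ^ (k + 1) * R ^ (k + 1) * (ρ / h) ^ k := by
          rw [show 2 * (2 * R * ρ / h) = 4 * R * (ρ / h) by ring, mul_pow, mul_pow, pow_succ (ρ / h)]
          field_simp
      _ ≤ 2 * 4 ^ (k + 1) * R ^ (k + 1) * (3 / 2 * (ρ / (h + ρ))) ^ k := by gcongr
      _ = 8 * (4 * (3 / 2)) ^ k * R ^ (k + 1) * (ρ / (h + ρ)) ^ k := by
          rw [mul_pow, mul_pow 4, pow_succ]; ring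
      _ ≤ 4 * 6 ^ (k + 1) * R ^ (k + 1) * (ρ / (h + ρ)) ^ k := by
          refine mul_le_mul_of_nonneg_right (mul_le_mul_of_nonneg_right ?_ (by positivity))
            (by positivity)
          rw [pow_succ, show (4 * (3 / 2) : ℝ) = 6 by norm_num]
          have : (0 : ℝ) < 6 ^ k := by positivity
          linarith
theorem lintegral_ofReal_comp_norm_addHaar [Nontrivial E] (x : E) {f : ℝ → ℝ} (hf : ∀ s, 0 ≤ f s)
    (hfint : IntegrableOn (fun s => s ^ (finrank ℝ E - 1) * f s) (Set.Ioi 0)) :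
    ∫⁻ y, ENNReal.ofReal (f ‖y - x‖) ∂μ =
      ENNReal.ofReal (finrank ℝ E * ∫ s in Set.Ioi 0, s ^ (finrank ℝ E - 1) * f s) *
        μ (ball 0 1) := by
  rw [lintegral_sub_right_eq_self (fun y => ENNReal.ofReal (f ‖y‖)) x,
    ← ofReal_integral_eq_lintegral_ofReal
      ((integrable_fun_norm_addHaar μ).2 (by simpa only [smul_eq_mul] using hfint))
      (Filter.Eventually.of_forall fun y => hf _),
    integral_fun_norm_addHaar, nsmul_eq_mul]
  simp only [smul_eq_mul]
  rw [show (finrank ℝ E : ℝ) * (μ.real (ball 0 1) * ∫ s in Set.Ioi 0, s ^ (finrank ℝ E - 1) * f s)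
    = ((finrank ℝ E : ℝ) * ∫ s in Set.Ioi 0, s ^ (finrank ℝ E - 1) * f s) * μ.real (ball 0 1) by
    ring, ENNReal.ofReal_mul' measureReal_nonneg, ofReal_measureReal (measure_ball_lt_top).ne]

theorem setLIntegral_closedBall_rpow_le [Nontrivial E] (x : E) {β D : ℝ} (hβ : 0 < β)
    (hD : 0 < D) :
    ∫⁻ y in closedBall x D, ENNReal.ofReal ‖y - x‖ ^ (β - finrank ℝ E) ∂μ ≤
      ENNReal.ofReal (finrank ℝ E / β * D ^ β) * μ (ball 0 1) := by
  have hd : 1 ≤ finrank ℝ E := finrank_pos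
  set f : ℝ → ℝ := (Set.Ioc 0 D).indicator fun s => s ^ (β - finrank ℝ E) with hf
  have hf0 : ∀ s, 0 ≤ f s := fun s =>
    Set.indicator_nonneg (fun t ht => Real.rpow_nonneg ht.1.le _) s
  have hfun : (fun s => s ^ (finrank ℝ E - 1) * f s) =
      (Set.Ioc 0 D).indicator fun s : ℝ => s ^ (β - 1) := by
    ext s
    by_cases hs : s ∈ Set.Ioc 0 D
    · simp only [hf, Set.indicator_of_mem hs]
      rw [← Real.rpow_natCast, ← Real.rpow_add hs.1]
      congr 1
      push_cast [hd]
      ring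
    · simp [hf, Set.indicator_of_notMem hs]
  have hintv : IntervalIntegrable (fun s : ℝ => s ^ (β - 1)) volume 0 D :=
    intervalIntegral.intervalIntegrable_rpow' (by linarith)
  have hfint : IntegrableOn (fun s => s ^ (finrank ℝ E - 1) * f s) (Set.Ioi 0) := by
    rw [hfun]
    refine Integrable.integrableOn ?_
    rw [integrable_indicator_iff measurableSet_Ioc]
    exact (intervalIntegrable_iff_integrableOn_Ioc_of_le hD.le).1 hintv
  have hval : ∫ s in Set.Ioi 0, s ^ (finrank ℝ E - 1) * f s = D ^ β / β := by
    rw [hfun, setIntegral_indicator measurableSet_Ioc, Set.inter_eq_right.2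
      (fun s hs => hs.1), ← intervalIntegral.integral_of_le hD.le,
      integral_rpow (Or.inl (by linarith))]
    simp [Real.zero_rpow hβ.ne']
  have key := lintegral_ofReal_comp_norm_addHaar μ x hf0 hfint
  rw [hval, ← mul_comm_div] at key
  rw [← key, ← lintegral_indicator measurableSet_closedBall]
  refine lintegral_mono_ae ?_
  have hx : ∀ᵐ y ∂μ, y ≠ x := by simp [ae_iff]
  filter_upwards [hx] with y hy
  by_cases hyD : y ∈ closedBall x D
  · have hpos : 0 < ‖y - x‖ := norm_pos_iff.2 (sub_ne_zero.2 hy)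
    rw [Set.indicator_of_mem hyD, ENNReal.ofReal_rpow_of_pos hpos, hf, Set.indicator_of_mem]
    exact ⟨hpos, by rwa [mem_closedBall, dist_eq_norm] at hyD⟩
  · simp [Set.indicator_of_notMem hyD]

theorem setLIntegral_annulus_le [Nontrivial E] (x : E) {a b : ℝ} (ha : 0 < a) (hab : a ≤ b) :
    ∫⁻ y in (fun y => ‖y - x‖) ⁻¹' Set.Icc a b, ENNReal.ofReal ((‖y - x‖ ^ finrank ℝ E)⁻¹) ∂μ ≤
      ENNReal.ofReal (finrank ℝ E * Real.log (b / a)) * μ (ball 0 1) := by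
  obtain ⟨k, hk⟩ : ∃ k, finrank ℝ E = k + 1 := Nat.exists_eq_succ_of_ne_zero finrank_pos.ne'
  set f : ℝ → ℝ := (Set.Icc a b).indicator fun s => (s ^ finrank ℝ E)⁻¹ with hf
  have hf0 : ∀ s, 0 ≤ f s := fun s =>
    Set.indicator_nonneg (fun t ht => inv_nonneg.2 (pow_nonneg (ha.le.trans ht.1) _)) s
  have hfun : (fun s => s ^ (finrank ℝ E - 1) * f s) =
      (Set.Icc a b).indicator fun s : ℝ => s⁻¹ := by
    ext s
    by_cases hs : s ∈ Set.Icc a b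
    · have : s ≠ 0 := (ha.trans_le hs.1).ne'
      simp only [hf, Set.indicator_of_mem hs, hk, Nat.add_sub_cancel, pow_succ]
      field_simp
    · simp [hf, Set.indicator_of_notMem hs]
  have hfint : IntegrableOn (fun s => s ^ (finrank ℝ E - 1) * f s) (Set.Ioi 0) := by
    rw [hfun]
    refine Integrable.integrableOn ?_
    rw [integrable_indicator_iff measurableSet_Icc]
    refine ContinuousOn.integrableOn_Icc (continuousOn_inv₀.mono ?_)
    exact fun s hs => (ha.trans_le hs.1).ne'
  have hval : ∫ s in Set.Ioi 0, s ^ (finrank ℝ E - 1) * f s = Real.log (b / a) := by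
    rw [hfun, setIntegral_indicator measurableSet_Icc, Set.inter_eq_right.2
      (show Set.Icc a b ⊆ Set.Ioi 0 from fun s hs => ha.trans_le hs.1), integral_Icc_eq_integral_Ioc,
      ← intervalIntegral.integral_of_le hab, integral_inv_of_pos ha (ha.trans_le hab)]
  have key := lintegral_ofReal_comp_norm_addHaar μ x hf0 hfint
  rw [hval] at key
  have hmeas : MeasurableSet ((fun y : E => ‖y - x‖) ⁻¹' Set.Icc a b) :=
    (isClosed_Icc.preimage (by fun_prop)).measurableSet
  rw [← key, ← lintegral_indicator hmeas]
  refine lintegral_mono fun y => ?_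
  by_cases hy : y ∈ ((fun y : E => ‖y - x‖) ⁻¹' Set.Icc a b)
  · rw [Set.indicator_of_mem hy, hf, Set.indicator_of_mem (show ‖y - x‖ ∈ Set.Icc a b from hy)]
  · simp [Set.indicator_of_notMem hy]

end Haar

/-- A finite family of measurable sets that splits into `N` disjoint subfamilies. -/
theorem sum_setLIntegral_le_of_coloring {α ι : Type*} [MeasurableSpace α] (μ : Measure α) {N : ℕ}
    (I : Finset ι) (col : ι → Fin N) (T : ι → Set α) (hT : ∀ i ∈ I, MeasurableSet (T i))
    (hdisj : ∀ i ∈ I, ∀ j ∈ I, i ≠ j → col i = col j → Disjoint (T i) (T j))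
    {Ω : Set α} (hΩ : ∀ i ∈ I, T i ⊆ Ω) (h : α → ℝ≥0∞) :
    ∑ i ∈ I, ∫⁻ y in T i, h y ∂μ ≤ N * ∫⁻ y in Ω, h y ∂μ := by
  rw [← Finset.sum_fiberwise_of_maps_to (t := Finset.univ) (g := col) (fun i _ => Finset.mem_univ _)]
  have : (N : ℝ≥0∞) * ∫⁻ y in Ω, h y ∂μ = ∑ _k : Fin N, ∫⁻ y in Ω, h y ∂μ := by simp
  rw [this]
  refine Finset.sum_le_sum fun k _ => ?_
  rw [← lintegral_biUnion_finset]
  · refine lintegral_mono_set (Set.iUnion₂_subset fun i hi => hΩ i (Finset.mem_filter.1 hi).1)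
  · intro i hi j hj hij
    simp only [Finset.coe_filter, Set.mem_ofPred_eq] at hi hj
    exact hdisj i hi.1 j hj.1 hij (hi.2.trans hj.2.symm)
  · intro i hi
    exact hT i (Finset.mem_filter.1 hi).1

theorem ENNReal.rpow_le_rpow_of_nonpos_right {a b : ℝ≥0∞} (h : a ≤ b) {z : ℝ} (hz : z ≤ 0) :
    b ^ z ≤ a ^ z := by
  obtain ⟨w, rfl⟩ : ∃ w, z = -w := ⟨-z, by ring⟩
  rw [ENNReal.rpow_neg, ENNReal.rpow_neg, ENNReal.inv_le_inv]
  exact ENNReal.rpow_le_rpow h (by linarith)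

section Potential

variable {E : Type*} [NormedAddCommGroup E] [NormedSpace ℝ E] [FiniteDimensional ℝ E]
  [MeasurableSpace E] [BorelSpace E]

/-- Discrete version of the integral `∫ ‖y - x‖ ^ (β - d)` over a family of balls with bounded
overlap. -/
theorem sum_pow_mul_rpow_le [Nontrivial E] (μ : Measure E) [μ.IsAddHaarMeasure] {ι : Type*} {N : ℕ}
    (I : Finset ι) (col : ι → Fin N) (c : ι → E) (r : ι → ℝ) (hr : ∀ i, 0 < r i)
    (hdisj : ∀ i ∈ I, ∀ j ∈ I, i ≠ j → col i = col j →
      Disjoint (ball (c i) (r i)) (ball (c j) (r j)))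
    (x : E) {D β : ℝ} (hD : ∀ i ∈ I, ‖c i - x‖ + r i ≤ D) (hD0 : 0 < D) (hβ : 0 < β)
    (hβd : β ≤ finrank ℝ E) :
    ∑ i ∈ I, r i ^ finrank ℝ E * (‖c i - x‖ + r i) ^ (β - finrank ℝ E) ≤
      N * (finrank ℝ E / β * D ^ β) := by
  have hδ : ∀ i, 0 < ‖c i - x‖ + r i := fun i => by have := hr i; positivity
  have h1 : ∀ i ∈ I, ENNReal.ofReal (r i ^ finrank ℝ E * (‖c i - x‖ + r i) ^ (β - finrank ℝ E)) *
      μ (ball 0 1) ≤ ∫⁻ y in ball (c i) (r i), ENNReal.ofReal ‖y - x‖ ^ (β - finrank ℝ E) ∂μ := by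
    intro i hi
    have hle : ∀ y ∈ ball (c i) (r i), ENNReal.ofReal (‖c i - x‖ + r i) ^ (β - finrank ℝ E) ≤
        ENNReal.ofReal ‖y - x‖ ^ (β - finrank ℝ E) := by
      intro y hy
      refine ENNReal.rpow_le_rpow_of_nonpos_right (ENNReal.ofReal_le_ofReal ?_) (by linarith)
      rw [mem_ball, dist_eq_norm] at hy
      have := norm_add_le (y - c i) (c i - x)
      rw [sub_add_sub_cancel] at this
      linarith
    refine le_trans (le_of_eq ?_) (setLIntegral_mono' measurableSet_ball hle)
    rw [setLIntegral_const, Measure.addHaar_ball μ _ (hr i).le, ENNReal.ofReal_rpow_of_pos (hδ i),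
      ENNReal.ofReal_mul (by have := hr i; positivity)]
    ring
  have h2 := sum_setLIntegral_le_of_coloring μ I col (fun i => ball (c i) (r i))
    (fun i _ => measurableSet_ball) hdisj (Ω := closedBall x D) (by
      intro i hi
      refine ball_subset_closedBall.trans (closedBall_subset_closedBall' ?_)
      rw [dist_eq_norm, add_comm]
      exact hD i hi) (fun y => ENNReal.ofReal ‖y - x‖ ^ (β - finrank ℝ E))
  have h3 := setLIntegral_closedBall_rpow_le μ x hβ hD0
  have h4 : ENNReal.ofReal (∑ i ∈ I, r i ^ finrank ℝ E * (‖c i - x‖ + r i) ^ (β - finrank ℝ E)) *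
      μ (ball 0 1) ≤ ENNReal.ofReal (N * (finrank ℝ E / β * D ^ β)) * μ (ball 0 1) := by
    rw [ENNReal.ofReal_sum_of_nonneg (fun i _ => by have := hr i; have := hδ i; positivity),
      Finset.sum_mul, ENNReal.ofReal_mul (by positivity), ENNReal.ofReal_natCast, mul_assoc]
    exact (Finset.sum_le_sum h1).trans (h2.trans (by gcongr))
  rw [ENNReal.mul_le_mul_iff_left (measure_ball_pos μ _ one_pos).ne' measure_ball_lt_top.ne] at h4
  exact (ENNReal.ofReal_le_ofReal_iff (by positivity)).1 h4

/-- Hölder's inequality for the discrete Riesz potential of a family of balls with bounded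
overlap. -/
theorem sum_potential_pow_le (μ : Measure E) [μ.IsAddHaarMeasure] {ι : Type*} {N : ℕ}
    (hd : 2 ≤ finrank ℝ E) (I : Finset ι)
    (col : ι → Fin N) (c : ι → E) (r : ι → ℝ) (hr : ∀ i, 0 < r i) (o : ι → ℝ) (ho : ∀ i, 0 ≤ o i)
    (hdisj : ∀ i ∈ I, ∀ j ∈ I, i ≠ j → col i = col j →
      Disjoint (ball (c i) (r i)) (ball (c j) (r j)))
    (x : E) {D : ℝ} (hD : ∀ i ∈ I, ‖c i - x‖ + r i ≤ D) (hD0 : 0 < D) :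
    (∑ i ∈ I, o i * (r i / (‖c i - x‖ + r i)) ^ (finrank ℝ E - 1)) ^ finrank ℝ E ≤
      (N * (2 * finrank ℝ E * (finrank ℝ E - 1))) ^ (finrank ℝ E - 1) * D ^ (1 / 2 : ℝ) *
        ∑ i ∈ I, o i ^ finrank ℝ E * (‖c i - x‖ + r i) ^ (-(1 / 2) : ℝ) := by
  have : Nontrivial E := nontrivial_of_finrank_pos (R := ℝ) (by omega)
  obtain ⟨k, hk⟩ : ∃ k, finrank ℝ E = k + 1 := Nat.exists_eq_succ_of_ne_zero (by omega)
  have hk0 : (0 : ℝ) < k := by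
    have : 0 < k := by omega
    exact_mod_cast this
  have hk1 : (1 : ℝ) ≤ k := by
    have : 1 ≤ k := by omega
    exact_mod_cast this
  set β : ℝ := 1 / (2 * k) with hβ
  have hβ0 : 0 < β := by positivity
  have hβ1 : β ≤ 1 := by rw [hβ, div_le_one (by positivity)]; linarith
  have hδ : ∀ i, 0 < ‖c i - x‖ + r i := fun i => by have := hr i; positivity
  have hW := sum_pow_mul_rpow_le μ I col c r hr hdisj x hD hD0 hβ0 (by rw [hk]; push_cast; linarith)
  rw [hk] at hW ⊢
  push_cast at hW ⊢
  simp only [add_sub_cancel_right]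
  set w : ι → ℝ := fun i => r i ^ (k + 1) * (‖c i - x‖ + r i) ^ (β - (k + 1)) with hw
  set a : ι → ℝ := fun i => o i * (‖c i - x‖ + r i) ^ (1 - β) / r i with ha
  have hw0 : ∀ i, 0 ≤ w i := fun i => by have := hr i; have := hδ i; positivity
  have ha0 : ∀ i, 0 ≤ a i := fun i => by have := hr i; have := hδ i; have := ho i; positivity
  have hwa : ∀ i, w i * a i = o i * (r i / (‖c i - x‖ + r i)) ^ k := by
    intro i
    have h1 := hr i
    have h2 := hδ i
    simp only [hw, ha]
    rw [show (β - (k + 1) : ℝ) = -(1 - β) - k by ring, Real.rpow_sub h2, Real.rpow_neg h2.le,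
      Real.rpow_natCast, div_pow, pow_succ]
    field_simp
  have hwap : ∀ i, w i * a i ^ ((k + 1 : ℕ) : ℝ) =
      o i ^ (k + 1) * (‖c i - x‖ + r i) ^ (-(1 / 2) : ℝ) := by
    intro i
    have h1 := hr i
    have h2 := hδ i
    simp only [hw, ha]
    rw [Real.rpow_natCast, div_pow, mul_pow, ← Real.rpow_natCast (_ ^ (1 - β)), ← Real.rpow_mul h2.le,
      show (-(1 / 2) : ℝ) = (β - (k + 1)) + (1 - β) * ((k + 1 : ℕ) : ℝ) by
        rw [hβ]; push_cast; field_simp; ring, Real.rpow_add h2]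
    field_simp
  have hH := Real.inner_le_weight_mul_Lp_of_nonneg I (p := ((k + 1 : ℕ) : ℝ))
    (by push_cast; linarith) w a hw0 ha0
  simp_rw [hwa, hwap] at hH
  set S := ∑ i ∈ I, o i ^ (k + 1) * (‖c i - x‖ + r i) ^ (-(1 / 2) : ℝ) with hS
  have hS0 : 0 ≤ S := Finset.sum_nonneg fun i _ => by have := hδ i; have := ho i; positivity
  have hW0 : 0 ≤ ∑ i ∈ I, w i := Finset.sum_nonneg fun i _ => hw0 i
  have hP0 : 0 ≤ ∑ i ∈ I, o i * (r i / (‖c i - x‖ + r i)) ^ k :=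
    Finset.sum_nonneg fun i _ => by have := hr i; have := hδ i; have := ho i; positivity
  calc (∑ i ∈ I, o i * (r i / (‖c i - x‖ + r i)) ^ k) ^ (k + 1)
      ≤ ((∑ i ∈ I, w i) ^ (1 - ((k + 1 : ℕ) : ℝ)⁻¹) * S ^ ((k + 1 : ℕ) : ℝ)⁻¹) ^ (k + 1) := by
        gcongr
    _ = (∑ i ∈ I, w i) ^ k * S := by
        rw [mul_pow, ← Real.rpow_mul_natCast hW0, ← Real.rpow_mul_natCast hS0,
          inv_mul_cancel₀ (by positivity), Real.rpow_one, sub_mul, inv_mul_cancel₀ (by positivity),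
          ← Real.rpow_natCast _ k]
        push_cast
        ring_nf
    _ ≤ (N * ((k + 1) / β * D ^ β)) ^ k * S := by gcongr
    _ = (N * (2 * (k + 1) * k)) ^ k * D ^ (1 / 2 : ℝ) * S := by
        rw [show (1 / 2 : ℝ) = β * k by rw [hβ]; field_simp, Real.rpow_mul_natCast hD0.le,
          ← mul_pow]
        congr 2
        rw [hβ]
        field_simp

/-- If `u` oscillates by at most `o i` on the balls of a cover of a ball `B`, the difference of its
values at two points of `B` is controlled by the discrete Riesz potentials at these points. -/
theorem abs_sub_le_potential [Nontrivial E] (μ : Measure E) [μ.IsAddHaarMeasure] {ι : Type*}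
    (x₀ : E) {R : ℝ} (hR : 0 < R) {u : E → ℝ} (hu : ContinuousOn u (closedBall x₀ R))
    (I : Finset ι) (c : ι → E) (r : ι → ℝ) (hr : ∀ i, 0 < r i) (o : ι → ℝ) (ho : ∀ i, 0 ≤ o i)
    (hcov : closedBall x₀ R ⊆ ⋃ i ∈ I, ball (c i) (r i))
    (hosc : ∀ i ∈ I, ∀ p ∈ closedBall x₀ R ∩ ball (c i) (r i),
      ∀ q ∈ closedBall x₀ R ∩ ball (c i) (r i), |u p - u q| ≤ o i)
    {x x' : E} (hx : x ∈ closedBall x₀ R) (hx' : x' ∈ closedBall x₀ R) :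
    |u x - u x'| ≤ 4 * 12 ^ finrank ℝ E *
      (∑ i ∈ I, o i * (r i / (‖c i - x‖ + r i)) ^ (finrank ℝ E - 1) +
        ∑ i ∈ I, o i * (r i / (‖c i - x'‖ + r i)) ^ (finrank ℝ E - 1)) := by
  classical
  set B := closedBall x₀ R with hB
  set S : E → ι → Set E := fun z i =>
    {y | y ∈ closedBall z (2 * R) ∧ (segment ℝ z y ∩ ball (c i) (r i)).Nonempty} with hS
  have hSmeas : ∀ z i, MeasurableSet (S z i) := by
    intro z i
    have : {y | (segment ℝ z y ∩ ball (c i) (r i)).Nonempty} =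
        ⋃ s ∈ Set.Icc (0 : ℝ) 1, (fun y => z + s • (y - z)) ⁻¹' ball (c i) (r i) := by
      ext y
      rw [Set.mem_iUnion₂]
      constructor
      · rintro ⟨w, hw, hwb⟩
        rw [segment_eq_image'] at hw
        obtain ⟨s, hs, rfl⟩ := hw
        exact ⟨s, hs, hwb⟩
      · rintro ⟨s, hs, hb⟩
        refine ⟨_, ?_, hb⟩
        rw [segment_eq_image']
        exact ⟨s, hs, rfl⟩
    have hopen : IsOpen {y | (segment ℝ z y ∩ ball (c i) (r i)).Nonempty} := by
      rw [this]
      exact isOpen_biUnion fun s _ => isOpen_ball.preimage (by fun_prop)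
    exact measurableSet_closedBall.inter hopen.measurableSet
  have hconv : Convex ℝ B := convex_closedBall x₀ R
  have hpt : ∀ z ∈ B, ∀ y ∈ B, ENNReal.ofReal |u z - u y| ≤
      ∑ i ∈ I, (S z i).indicator (fun _ => ENNReal.ofReal (o i)) y := by
    intro z hz y hy
    have hseg : segment ℝ z y ⊆ B := hconv.segment_subset hz hy
    have h1 := (convex_segment z y).isPreconnected.abs_sub_le_sum_osc (hu.mono hseg) I
      (fun i => ball (c i) (r i)) (hseg.trans hcov) o (fun i _ => ho i)
      (fun i hi p hp q hq => hosc i hi p ⟨hseg hp.1, hp.2⟩ q ⟨hseg hq.1, hq.2⟩)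
      (left_mem_segment ℝ z y) (right_mem_segment ℝ z y)
    refine (ENNReal.ofReal_le_ofReal h1).trans ?_
    rw [ENNReal.ofReal_sum_of_nonneg (fun i _ => by split_ifs; exacts [ho i, le_rfl])]
    refine Finset.sum_le_sum fun i _ => ?_
    split_ifs with h
    · rw [Set.indicator_of_mem]
      refine ⟨?_, h⟩
      rw [hB, mem_closedBall] at hz hy
      rw [mem_closedBall]
      have := dist_triangle_right y z x₀
      linarith
    · simp
  have hshadow : ∀ z i, ENNReal.ofReal (o i) * μ (S z i) ≤
      ENNReal.ofReal (4 * 12 ^ finrank ℝ E * R ^ finrank ℝ E *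
        (o i * (r i / (‖c i - z‖ + r i)) ^ (finrank ℝ E - 1))) * μ (ball 0 1) := by
    intro z i
    have h0 := hr i
    have h1 := ho i
    refine (mul_le_mul_right (addHaar_shadow_le μ z (c i) (hr i)
      (by positivity : 0 < 2 * R)) _).trans (le_of_eq ?_)
    rw [← mul_assoc, ← ENNReal.ofReal_mul (ho i)]
    congr 2
    rw [mul_pow, show (12 : ℝ) = 6 * 2 by norm_num, mul_pow]
    ring
  have hfint : ∀ z ∈ B, ∫⁻ y in B, ENNReal.ofReal |u z - u y| ∂μ ≤
      ENNReal.ofReal (4 * 12 ^ finrank ℝ E * R ^ finrank ℝ E *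
        ∑ i ∈ I, o i * (r i / (‖c i - z‖ + r i)) ^ (finrank ℝ E - 1)) * μ (ball 0 1) := by
    intro z hz
    calc ∫⁻ y in B, ENNReal.ofReal |u z - u y| ∂μ
        ≤ ∫⁻ y in B, ∑ i ∈ I, (S z i).indicator (fun _ => ENNReal.ofReal (o i)) y ∂μ :=
          setLIntegral_mono' measurableSet_closedBall (hpt z hz)
      _ ≤ ∫⁻ y, ∑ i ∈ I, (S z i).indicator (fun _ => ENNReal.ofReal (o i)) y ∂μ :=
          setLIntegral_le_lintegral _ _
      _ = ∑ i ∈ I, ENNReal.ofReal (o i) * μ (S z i) := by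
          rw [lintegral_finsetSum]
          · simp_rw [lintegral_indicator_const (hSmeas z _)]
          · exact fun i _ => measurable_const.indicator (hSmeas z i)
      _ ≤ _ := by
          refine (Finset.sum_le_sum fun i _ => hshadow z i).trans (le_of_eq ?_)
          rw [← Finset.sum_mul, ← ENNReal.ofReal_sum_of_nonneg, Finset.mul_sum]
          intro i _
          have h0 := hr i
          have h1 := ho i
          positivity
  have hP0 : ∀ z, 0 ≤ ∑ i ∈ I, o i * (r i / (‖c i - z‖ + r i)) ^ (finrank ℝ E - 1) :=
    fun z => Finset.sum_nonneg fun i _ => by have h0 := hr i; have h1 := ho i; positivity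
  have hfin : ENNReal.ofReal (|u x - u x'| * R ^ finrank ℝ E) * μ (ball 0 1) ≤
      ENNReal.ofReal (4 * 12 ^ finrank ℝ E * R ^ finrank ℝ E *
        ∑ i ∈ I, o i * (r i / (‖c i - x‖ + r i)) ^ (finrank ℝ E - 1) +
        4 * 12 ^ finrank ℝ E * R ^ finrank ℝ E *
        ∑ i ∈ I, o i * (r i / (‖c i - x'‖ + r i)) ^ (finrank ℝ E - 1)) * μ (ball 0 1) := by
    have hP := hP0 x
    have hP' := hP0 x'
    rw [ENNReal.ofReal_add (by positivity) (by positivity), add_mul]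
    refine le_trans ?_ (add_le_add (hfint x hx) (hfint x' hx'))
    have hmeas : AEMeasurable (fun y => ENNReal.ofReal |u x - u y|) (μ.restrict B) := by
      refine (ContinuousOn.aemeasurable ?_ measurableSet_closedBall).ennreal_ofReal
      exact (continuousOn_const.sub hu).abs
    rw [← lintegral_add_left' hmeas, ENNReal.ofReal_mul (abs_nonneg _), mul_assoc,
      ← Measure.addHaar_closedBall μ x₀ hR.le, ← setLIntegral_const]
    refine lintegral_mono fun y => ?_
    rw [← ENNReal.ofReal_add (abs_nonneg _) (abs_nonneg _)]
    refine ENNReal.ofReal_le_ofReal ?_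
    have := abs_sub_le (u x) (u y) (u x')
    rwa [abs_sub_comm (u y) (u x')] at this
  rw [ENNReal.mul_le_mul_iff_left (measure_ball_pos μ _ one_pos).ne' measure_ball_lt_top.ne] at hfin
  have hP := hP0 x
  have hP' := hP0 x'
  have h5 := (ENNReal.ofReal_le_ofReal_iff (by positivity)).1 hfin
  have hRd : 0 < R ^ finrank ℝ E := by positivity
  nlinarith

/-- A lower bound for the discrete conformal energy of a function that takes the value `0` on a
set meeting all spheres of radius `t ≤ R` around `x₀` and the value `1` on a set meeting all spheres
of radius between `R` and `2 * R`. -/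
theorem one_le_sum_osc_pow (μ : Measure E) [μ.IsAddHaarMeasure] {ι : Type*} {N : ℕ}
    (hd : 2 ≤ finrank ℝ E) (x₀ : E) {R : ℝ} (hR : 0 < R) {u : E → ℝ}
    (hu : ContinuousOn u (closedBall x₀ (2 * R))) (I : Finset ι) (col : ι → Fin N) (c : ι → E)
    (r : ι → ℝ) (hr : ∀ i, 0 < r i) (hrR : ∀ i ∈ I, r i ≤ R)
    (hc : ∀ i ∈ I, c i ∈ closedBall x₀ (2 * R)) (o : ι → ℝ) (ho : ∀ i, 0 ≤ o i)
    (hdisj : ∀ i ∈ I, ∀ j ∈ I, i ≠ j → col i = col j →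
      Disjoint (ball (c i) (r i)) (ball (c j) (r j)))
    (hcov : closedBall x₀ (2 * R) ⊆ ⋃ i ∈ I, ball (c i) (r i))
    (hosc : ∀ i ∈ I, ∀ p ∈ closedBall x₀ (2 * R) ∩ ball (c i) (r i),
      ∀ q ∈ closedBall x₀ (2 * R) ∩ ball (c i) (r i), |u p - u q| ≤ o i)
    (hp : ∀ t ∈ Set.Ioc 0 R, ∃ p, ‖p - x₀‖ = t ∧ u p = 0)
    (hq : ∀ t ∈ Set.Ioc 0 R, ∃ q, ‖q - x₀‖ = R + t ∧ u q = 1) :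
    1 ≤ ((4 * 12 ^ finrank ℝ E) ^ finrank ℝ E * 2 ^ (finrank ℝ E - 1) *
        (N * (2 * finrank ℝ E * (finrank ℝ E - 1))) ^ (finrank ℝ E - 1) * 40) *
      ∑ i ∈ I, o i ^ finrank ℝ E := by
  have : Nontrivial E := nontrivial_of_finrank_pos (R := ℝ) (by omega)
  have hd' : (1 : ℝ) ≤ finrank ℝ E := by
    have : 1 ≤ finrank ℝ E := by omega
    exact_mod_cast this
  set M : ℝ := (N * (2 * finrank ℝ E * (finrank ℝ E - 1))) ^ (finrank ℝ E - 1) with hM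
  have hM0 : 0 ≤ M := by
    have : (0 : ℝ) ≤ finrank ℝ E - 1 := by linarith
    positivity
  set K : ℝ := (4 * 12 ^ finrank ℝ E) ^ finrank ℝ E * 2 ^ (finrank ℝ E - 1) * M with hK
  have hK0 : 0 ≤ K := by positivity
  have hδ : ∀ z i, 0 < ‖c i - z‖ + r i := fun z i => by have := hr i; positivity
  have hpow : ∀ z ∈ closedBall x₀ (2 * R), ∀ t, ‖z - x₀‖ = t →
      ENNReal.ofReal ((∑ i ∈ I, o i * (r i / (‖c i - z‖ + r i)) ^ (finrank ℝ E - 1)) ^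
        finrank ℝ E) ≤ ENNReal.ofReal (M * (5 * R) ^ (1 / 2 : ℝ)) *
        ∑ i ∈ I, ENNReal.ofReal (o i ^ finrank ℝ E) *
          ENNReal.ofReal ‖t - ‖c i - x₀‖‖ ^ (1 / 2 - finrank ℝ ℝ : ℝ) := by
    intro z hz t ht
    have h1 := sum_potential_pow_le μ hd I col c r hr o ho hdisj z (D := 5 * R) (by
      intro i hi
      have h2 := hrR i hi
      have h3 := hc i hi
      rw [mem_closedBall] at hz h3
      have := dist_triangle_right (c i) z x₀
      rw [← dist_eq_norm]
      linarith) (by positivity)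
    refine (ENNReal.ofReal_le_ofReal h1).trans ?_
    rw [ENNReal.ofReal_mul (by positivity), ENNReal.ofReal_sum_of_nonneg
      (fun i _ => by have := hδ z i; have := ho i; positivity)]
    gcongr with i hi
    rw [ENNReal.ofReal_mul (by have := ho i; positivity), ← ENNReal.ofReal_rpow_of_pos (hδ z i)]
    gcongr
    rw [finrank_self, show (1 / 2 - (1 : ℕ) : ℝ) = -(1 / 2) by norm_num]
    refine ENNReal.rpow_le_rpow_of_nonpos_right (ENNReal.ofReal_le_ofReal ?_) (by norm_num)
    rw [← ht, Real.norm_eq_abs]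
    have h2 := abs_norm_sub_norm_le (z - x₀) (c i - x₀)
    rw [sub_sub_sub_cancel_right, norm_sub_rev z (c i)] at h2
    have := hr i
    linarith
  have hone : ∀ t ∈ Set.Ioc 0 R, (1 : ℝ≥0∞) ≤ ENNReal.ofReal (K * (5 * R) ^ (1 / 2 : ℝ)) *
      ∑ i ∈ I, ENNReal.ofReal (o i ^ finrank ℝ E) *
        (ENNReal.ofReal ‖t - ‖c i - x₀‖‖ ^ (1 / 2 - finrank ℝ ℝ : ℝ) +
          ENNReal.ofReal ‖t - (‖c i - x₀‖ - R)‖ ^ (1 / 2 - finrank ℝ ℝ : ℝ)) := by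
    intro t ht
    obtain ⟨x, hx, hux⟩ := hp t ht
    obtain ⟨y, hy, huy⟩ := hq t ht
    have hxB : x ∈ closedBall x₀ (2 * R) := by
      rw [mem_closedBall, dist_eq_norm, hx]; linarith [ht.2]
    have hyB : y ∈ closedBall x₀ (2 * R) := by
      rw [mem_closedBall, dist_eq_norm, hy]; linarith [ht.2]
    have h1 := abs_sub_le_potential μ x₀ (by positivity) hu I c r hr o ho hcov hosc hxB hyB
    rw [hux, huy] at h1
    norm_num at h1
    have hPx := hpow x hxB t hx
    have hPy := hpow y hyB (R + t) hy
    set Px := ∑ i ∈ I, o i * (r i / (‖c i - x‖ + r i)) ^ (finrank ℝ E - 1)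
    set Py := ∑ i ∈ I, o i * (r i / (‖c i - y‖ + r i)) ^ (finrank ℝ E - 1)
    have hPx0 : 0 ≤ Px := Finset.sum_nonneg fun i _ => by
      have := hr i; have := ho i; positivity
    have hPy0 : 0 ≤ Py := Finset.sum_nonneg fun i _ => by
      have := hr i; have := ho i; positivity
    have h2 : 1 ≤ (4 * 12 ^ finrank ℝ E) ^ finrank ℝ E * 2 ^ (finrank ℝ E - 1) *
        (Px ^ finrank ℝ E + Py ^ finrank ℝ E) := by
      have h3 := one_le_pow₀ (n := finrank ℝ E) h1
      rw [mul_pow] at h3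
      refine h3.trans ?_
      rw [mul_assoc]
      gcongr
      exact add_pow_le hPx0 hPy0 _
    have h4 : (1 : ℝ≥0∞) ≤ ENNReal.ofReal ((4 * 12 ^ finrank ℝ E) ^ finrank ℝ E *
        2 ^ (finrank ℝ E - 1)) * (ENNReal.ofReal (Px ^ finrank ℝ E) +
          ENNReal.ofReal (Py ^ finrank ℝ E)) := by
      rw [← ENNReal.ofReal_add (by positivity) (by positivity), ← ENNReal.ofReal_mul (by positivity)]
      exact ENNReal.one_le_ofReal.2 h2
    refine h4.trans ((mul_le_mul_right (add_le_add hPx hPy) _).trans (le_of_eq ?_))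
    rw [← mul_add, ← Finset.sum_add_distrib, ← mul_assoc, ← ENNReal.ofReal_mul (by positivity),
      hK]
    congr 1
    · congr 1
      ring
    refine Finset.sum_congr rfl fun i _ => ?_
    rw [← mul_add, show R + t - ‖c i - x₀‖ = t - (‖c i - x₀‖ - R) by ring]
  have hradial : ∀ τ : ℝ, τ ∈ Set.Icc (-R) (2 * R) →
      ∫⁻ t in Set.Ioc 0 R, ENNReal.ofReal ‖t - τ‖ ^ (1 / 2 - finrank ℝ ℝ : ℝ) ≤
        ENNReal.ofReal (4 * (3 * R) ^ (1 / 2 : ℝ)) := by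
    intro τ hτ
    have h1 := setLIntegral_closedBall_rpow_le (volume : Measure ℝ) τ (β := 1 / 2) (D := 3 * R)
      (by norm_num) (by positivity)
    rw [Real.volume_ball, ← ENNReal.ofReal_mul (by positivity)] at h1
    refine (lintegral_mono_set ?_).trans (h1.trans (le_of_eq ?_))
    · intro t ht
      rw [mem_closedBall, Real.dist_eq, abs_le]
      constructor <;> linarith [ht.1, ht.2, hτ.1, hτ.2]
    · congr 1
      rw [finrank_self]
      push_cast
      ring
  have hmeas : ∀ τ : ℝ, Measurable fun t : ℝ =>
      ENNReal.ofReal ‖t - τ‖ ^ (1 / 2 - finrank ℝ ℝ : ℝ) := fun τ => by fun_prop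
  have hIntegrated : ENNReal.ofReal R ≤ ENNReal.ofReal (K * (5 * R) ^ (1 / 2 : ℝ)) *
      ∑ i ∈ I, ENNReal.ofReal (o i ^ finrank ℝ E) *
        (ENNReal.ofReal (4 * (3 * R) ^ (1 / 2 : ℝ)) +
          ENNReal.ofReal (4 * (3 * R) ^ (1 / 2 : ℝ))) := by
    calc ENNReal.ofReal R = ∫⁻ _ in Set.Ioc 0 R, (1 : ℝ≥0∞) := by simp
      _ ≤ _ := setLIntegral_mono' measurableSet_Ioc hone
      _ = ENNReal.ofReal (K * (5 * R) ^ (1 / 2 : ℝ)) *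
          ∑ i ∈ I, ENNReal.ofReal (o i ^ finrank ℝ E) *
          ((∫⁻ t in Set.Ioc 0 R, ENNReal.ofReal ‖t - ‖c i - x₀‖‖ ^ (1 / 2 - finrank ℝ ℝ : ℝ)) +
          ∫⁻ t in Set.Ioc 0 R,
            ENNReal.ofReal ‖t - (‖c i - x₀‖ - R)‖ ^ (1 / 2 - finrank ℝ ℝ : ℝ)) := by
          rw [lintegral_const_mul' _ _ ENNReal.ofReal_ne_top, lintegral_finsetSum]
          · congr 1
            refine Finset.sum_congr rfl fun i _ => ?_
            rw [lintegral_const_mul' _ _ ENNReal.ofReal_ne_top, lintegral_add_left (hmeas _)]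
          · exact fun i _ => ((hmeas _).add (hmeas _)).const_mul _
      _ ≤ _ := by
          gcongr with i hi
          all_goals
            have h1 := hc i hi
            rw [mem_closedBall, dist_eq_norm] at h1
            have h2 := norm_nonneg (c i - x₀)
            exact hradial _ ⟨by linarith, by linarith⟩
  have hS0 : 0 ≤ ∑ i ∈ I, o i ^ finrank ℝ E :=
    Finset.sum_nonneg fun i _ => by have := ho i; positivity
  have hreal : R ≤ K * (5 * R) ^ (1 / 2 : ℝ) * ((∑ i ∈ I, o i ^ finrank ℝ E) *
      (4 * (3 * R) ^ (1 / 2 : ℝ) + 4 * (3 * R) ^ (1 / 2 : ℝ))) := by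
    rw [← ENNReal.ofReal_add (by positivity) (by positivity), ← Finset.sum_mul,
      ← ENNReal.ofReal_sum_of_nonneg (fun i _ => by have := ho i; positivity),
      ← ENNReal.ofReal_mul hS0, ← ENNReal.ofReal_mul (by positivity)] at hIntegrated
    exact (ENNReal.ofReal_le_ofReal_iff (by positivity)).1 hIntegrated
  have hsqrt : (5 * R) ^ (1 / 2 : ℝ) * (3 * R) ^ (1 / 2 : ℝ) ≤ 5 * R := by
    calc (5 * R) ^ (1 / 2 : ℝ) * (3 * R) ^ (1 / 2 : ℝ)
        ≤ (5 * R) ^ (1 / 2 : ℝ) * (5 * R) ^ (1 / 2 : ℝ) := by gcongr; norm_num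
      _ = 5 * R := by
        rw [← Real.rpow_add (by positivity)]
        norm_num
  have h6 : R ≤ K * 40 * (∑ i ∈ I, o i ^ finrank ℝ E) * R := by
    calc R ≤ _ := hreal
      _ = K * 8 * (∑ i ∈ I, o i ^ finrank ℝ E) *
          ((5 * R) ^ (1 / 2 : ℝ) * (3 * R) ^ (1 / 2 : ℝ)) := by ring
      _ ≤ K * 8 * (∑ i ∈ I, o i ^ finrank ℝ E) * (5 * R) := by gcongr
      _ = _ := by ring
  by_contra hcon
  push Not at hcon
  nlinarith

end Potential

/-- A bound on the linear dilatation at `x` produces arbitrarily small balls around `x` with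
controlled eccentricity of the image. -/
theorem exists_radius_of_linearDilatationOn_lt {E F : Type*} [NormedAddCommGroup E]
    [NormedSpace ℝ E] [Nontrivial E] [MetricSpace F] {U : Set E} (hU : IsOpen U) {f : E → F}
    (hinj : Set.InjOn f U) {x : E} (hx : x ∈ U) {K : ℝ}
    (hK : linearDilatationOn f U x < ENNReal.ofReal K) {δ : ℝ} (hδ : 0 < δ) :
    ∃ r ∈ Set.Ioo 0 δ, ∃ s > 0, (∀ y ∈ U, dist x y ≤ r → dist (f x) (f y) ≤ K * s) ∧
      ∀ y ∈ U, r ≤ dist x y → s ≤ dist (f x) (f y) := by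
  obtain ⟨ρ, hρ, hρU⟩ := Metric.isOpen_iff.1 hU x hx
  have hev := Filter.eventually_lt_of_limsup_lt hK
  obtain ⟨r, hr, hr0, hrδ⟩ := (hev.and (Ioo_mem_nhdsGT (lt_min hδ hρ))).exists
  have hK0 : 0 < K := by
    by_contra h
    rw [ENNReal.ofReal_of_nonpos (not_lt.1 h)] at hK
    exact not_lt_zero hK
  obtain ⟨v, hv⟩ := exists_norm_eq E hr0.le
  have hdv : dist x (x + v) = r := by simp [hv]
  have hvU : x + v ∈ U := hρU (by
    rw [Metric.mem_ball, dist_comm, hdv]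
    exact hrδ.trans_le (min_le_right _ _))
  have hne : edist (f x) (f (x + v)) ≠ 0 := by
    rw [Ne, edist_eq_zero]
    intro h
    have := hinj hx hvU h
    rw [← this, dist_self] at hdv
    exact hr0.ne hdv
  set S := ⨆ y ∈ {y ∈ U | dist x y ≤ r}, edist (f x) (f y) with hS
  set T := ⨅ y ∈ {y ∈ U | r ≤ dist x y}, edist (f x) (f y) with hT
  have hle : ∀ y ∈ U, dist x y ≤ r → edist (f x) (f y) ≤ S := fun y hy hxy =>
    le_iSup₂_of_le y ⟨hy, hxy⟩ le_rfl
  have hge : ∀ y ∈ U, r ≤ dist x y → T ≤ edist (f x) (f y) := fun y hy hxy =>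
    iInf₂_le_of_le y ⟨hy, hxy⟩ le_rfl
  have hTtop : T ≠ ⊤ := ne_top_of_le_ne_top (edist_ne_top _ _) (hge _ hvU hdv.ge)
  have hSpos : S ≠ 0 := fun h => hne (le_antisymm (h ▸ hle _ hvU hdv.le) bot_le)
  have hTpos : T ≠ 0 := by
    intro h
    rw [h, ENNReal.div_zero hSpos] at hr
    exact not_top_lt hr
  have hST : S ≤ ENNReal.ofReal K * T :=
    ((ENNReal.div_lt_iff (Or.inl hTpos) (Or.inl hTtop)).1 hr).le
  refine ⟨r, ⟨hr0, hrδ.trans_le (min_le_left _ _)⟩, T.toReal, ENNReal.toReal_pos hTpos hTtop,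
    fun y hy hxy => ?_, fun y hy hxy => ?_⟩
  · have := ENNReal.toReal_mono (ENNReal.mul_ne_top ENNReal.ofReal_ne_top hTtop)
      ((hle y hy hxy).trans hST)
    rwa [ENNReal.toReal_mul, ENNReal.toReal_ofReal hK0.le, edist_dist,
      ENNReal.toReal_ofReal dist_nonneg] at this
  · have := ENNReal.toReal_mono (edist_ne_top _ _) (hge y hy hxy)
    rwa [edist_dist, ENNReal.toReal_ofReal dist_nonneg] at this

section Crossing

variable {E : Type*} [NormedAddCommGroup E] [NormedSpace ℝ E] [FiniteDimensional ℝ E]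

/-- A connected set that meets the image of a ball without being contained in it meets the image of
the bounding sphere. -/
theorem OpenPartialHomeomorph.exists_dist_eq_of_isPreconnected (e : OpenPartialHomeomorph E E)
    {x : E} {t : ℝ} (ht : closedBall x t ⊆ e.source) {S : Set E} (hS : IsPreconnected S)
    (hne : (S ∩ e '' ball x t).Nonempty) (hsub : ¬S ⊆ e '' ball x t) :
    ∃ p, dist p x = t ∧ e p ∈ S := by
  have : ProperSpace E := FiniteDimensional.proper ℝ E
  by_contra! h
  refine hsub (hS.subset_of_closure_inter_subset
    (e.isOpen_image_of_subset_source isOpen_ball (ball_subset_closedBall.trans ht)) hne ?_)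
  rintro z ⟨hz, hzS⟩
  have hcl : IsClosed (e '' closedBall x t) :=
    ((isCompact_closedBall x t).image_of_continuousOn (e.continuousOn.mono ht)).isClosed
  obtain ⟨y, hy, rfl⟩ := closure_minimal (Set.image_mono ball_subset_closedBall) hcl hz
  exact ⟨y, mem_ball.2 ((mem_closedBall.1 hy).lt_of_ne fun hyt => h y hyt hzS), rfl⟩

theorem OpenPartialHomeomorph.ball_subset_image_ball (e : OpenPartialHomeomorph E E)
    {x : E} {r s : ℝ} (hr0 : 0 < r) (hr : closedBall x r ⊆ e.source) (hs : 0 < s)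
    (h : ∀ y ∈ e.source, r ≤ dist x y → s ≤ dist (e x) (e y)) :
    ball (e x) s ⊆ e '' ball x r := by
  by_contra hsub
  obtain ⟨p, hp, hpS⟩ := e.exists_dist_eq_of_isPreconnected hr (convex_ball (e x) s).isPreconnected
    ⟨e x, mem_ball_self hs, x, mem_ball_self hr0, rfl⟩ hsub
  rw [mem_ball, dist_comm] at hpS
  exact (h p (hr hp.le) (by rw [dist_comm, hp])).not_gt hpS

theorem OpenPartialHomeomorph.exists_dist_eq_dist_image_le (e : OpenPartialHomeomorph E E)
    {x b : E} {t : ℝ} (ht0 : 0 < t) (ht : closedBall x t ⊆ e.source) (hb : b ∈ e.source)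
    (hxb : t ≤ dist b x) :
    ∃ p, dist p x = t ∧ dist (e p) (e x) ≤ dist (e b) (e x) := by
  refine e.exists_dist_eq_of_isPreconnected ht
    (convex_closedBall (e x) (dist (e b) (e x))).isPreconnected
    ⟨e x, mem_closedBall_self dist_nonneg, x, mem_ball_self ht0, rfl⟩ fun hsub => ?_
  obtain ⟨y, hy, hyb⟩ := hsub (mem_closedBall.2 le_rfl)
  have := e.injOn (ht (ball_subset_closedBall hy)) hb hyb
  rw [this] at hy
  exact hxb.not_gt hy

theorem OpenPartialHomeomorph.exists_dist_eq_le_dist_image (e : OpenPartialHomeomorph E E)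
    {x a : E} {t : ℝ} (ht : closedBall x t ⊆ e.source) (hne : e a ≠ e x) (hxa : dist a x < t) :
    ∃ q, dist q x = t ∧ dist (e a) (e x) ≤ dist (e q) (e x) := by
  have : ProperSpace E := FiniteDimensional.proper ℝ E
  have hS : IsPreconnected ((fun s : ℝ => e x + s • (e a - e x)) '' Set.Ici 1) :=
    (convex_Ici 1).isPreconnected.image _ (by fun_prop)
  have hdist : ∀ s : ℝ, 1 ≤ s →
      dist (e x + s • (e a - e x)) (e x) = s * dist (e a) (e x) := fun s hs => by
    rw [dist_eq_norm, add_sub_cancel_left, norm_smul, Real.norm_of_nonneg (by linarith),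
      dist_eq_norm]
  have hpos : 0 < dist (e a) (e x) := dist_pos.2 hne
  obtain ⟨q, hq, s, hs, hsq⟩ := e.exists_dist_eq_of_isPreconnected ht hS
    ⟨e a, ⟨1, Set.self_mem_Ici, by simp⟩, a, hxa, rfl⟩ fun hsub => by
      obtain ⟨ρ, hρ⟩ := (((isCompact_closedBall x t).image_of_continuousOn
        (e.continuousOn.mono ht)).isBounded.subset
          (Set.image_mono ball_subset_closedBall)).subset_closedBall (e x)
      have hs : 1 ≤ 1 + |ρ| / dist (e a) (e x) := le_add_of_nonneg_right (by positivity)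
      have h1 := hρ (hsub ⟨_, hs, rfl⟩)
      rw [mem_closedBall] at h1
      simp only [hdist _ hs] at h1
      rw [add_mul, div_mul_cancel₀ _ hpos.ne'] at h1
      linarith [le_abs_self ρ]
  refine ⟨q, hq, ?_⟩
  rw [← hsq]
  simp only [hdist s hs]
  exact le_mul_of_one_le_left hpos.le hs

end Crossing

/-- The Besicovitch covering theorem for compact sets, as a colouring of a finite subcover. -/
theorem HasBesicovitchCovering.exists_finset_coloring (E : Type*) [MetricSpace E]
    [HasBesicovitchCovering E] :
    ∃ N : ℕ, ∀ K : Set E, IsCompact K → ∀ r : K → ℝ, (∀ i, 0 < r i) → ∀ D : ℝ, (∀ i, r i ≤ D) →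
      ∃ (I : Finset K) (col : K → Fin N), K ⊆ ⋃ i ∈ I, ball (i : E) (r i) ∧
        ∀ i ∈ I, ∀ j ∈ I, i ≠ j → col i = col j →
          Disjoint (ball (i : E) (r i)) (ball (j : E) (r j)) := by
  classical
  obtain ⟨N, τ, hτ, hN⟩ := HasBesicovitchCovering.no_satelliteConfig (α := E)
  refine ⟨N + 1, fun K hK r hr D hD => ?_⟩
  obtain ⟨s, hs, hcov⟩ := Besicovitch.exist_disjoint_covering_families hτ hN
    { c := fun i : K => (i : E), r := r, rpos := hr, r_bound := D, r_le := hD }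
  simp only [Subtype.range_coe_subtype, Set.ofPred_mem_eq] at hcov
  obtain ⟨I, hI⟩ := hK.elim_finite_subcover (fun i : ⋃ k, s k => ball ((i : K) : E) (r i))
    (fun i => isOpen_ball) (hcov.trans (by
      intro y hy
      simp only [Set.mem_iUnion] at hy ⊢
      obtain ⟨k, j, hj, hy⟩ := hy
      exact ⟨⟨j, Set.mem_iUnion.2 ⟨k, hj⟩⟩, hy⟩))
  refine ⟨I.image Subtype.val, fun i => if h : ∃ k, i ∈ s k then h.choose.castSucc else Fin.last N,
    hI.trans ?_, ?_⟩
  · intro y hy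
    simp only [Set.mem_iUnion] at hy ⊢
    obtain ⟨i, hi, hy⟩ := hy
    exact ⟨i, Finset.mem_image_of_mem _ hi, hy⟩
  · intro i hi j hj hij hcol
    obtain ⟨⟨i, hi'⟩, -, rfl⟩ := Finset.mem_image.1 hi
    obtain ⟨⟨j, hj'⟩, -, rfl⟩ := Finset.mem_image.1 hj
    rw [Set.mem_iUnion] at hi' hj'
    simp only [dif_pos hi', dif_pos hj', Fin.castSucc_inj] at hcol
    exact (hs hi'.choose hi'.choose_spec (by rw [hcol]; exact hj'.choose_spec) hij).mono
      ball_subset_closedBall ball_subset_closedBall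

/-- The logarithmic energy of a family of balls of bounded overlap in an annulus. -/
theorem sum_div_pow_le_log {E : Type*} [NormedAddCommGroup E] [NormedSpace ℝ E]
    [FiniteDimensional ℝ E] [MeasurableSpace E] [BorelSpace E] [Nontrivial E] (μ : Measure E)
    [μ.IsAddHaarMeasure] {ι : Type*} {N : ℕ} (I : Finset ι) (col : ι → Fin N) (w : ι → E)
    (s : ι → ℝ) (hs : ∀ i ∈ I, 0 < s i) (y₀ : E) {l L : ℝ} (hl : 0 < l) (hlL : l ≤ L)
    (hsl : ∀ i ∈ I, s i ≤ l / 4) (hwl : ∀ i ∈ I, l / 2 ≤ ‖w i - y₀‖)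
    (hwL : ∀ i ∈ I, ‖w i - y₀‖ ≤ 2 * L)
    (hdisj : ∀ i ∈ I, ∀ j ∈ I, i ≠ j → col i = col j →
      Disjoint (ball (w i) (s i)) (ball (w j) (s j))) :
    ∑ i ∈ I, (s i / ‖w i - y₀‖) ^ finrank ℝ E ≤
      N * 2 ^ finrank ℝ E * finrank ℝ E * Real.log (16 * (L / l)) := by
  set d := finrank ℝ E with hd
  have hL : 0 < L := hl.trans_le hlL
  have hlog : 0 ≤ Real.log (16 * (L / l)) := Real.log_nonneg (by
    have : 1 ≤ L / l := (one_le_div hl).2 hlL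
    linarith)
  have hw0 : ∀ i ∈ I, 0 < ‖w i - y₀‖ := fun i hi => by linarith [hwl i hi]
  have hμ0 : μ (ball 0 1) ≠ 0 := (measure_ball_pos μ 0 one_pos).ne'
  have hμt : μ (ball 0 1) ≠ ⊤ := measure_ball_lt_top.ne
  have key : ∀ i ∈ I, ENNReal.ofReal ((s i / ‖w i - y₀‖) ^ d) * μ (ball 0 1) ≤
      ∫⁻ y in ball (w i) (s i), ENNReal.ofReal (2 ^ d) *
        ENNReal.ofReal ((‖y - y₀‖ ^ d)⁻¹) ∂μ := by
    intro i hi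
    have h1 := hw0 i hi
    rw [div_pow, div_eq_inv_mul, ENNReal.ofReal_mul (by positivity), mul_assoc,
      ← Measure.addHaar_ball μ (w i) (hs i hi).le, ← setLIntegral_const]
    refine setLIntegral_mono' measurableSet_ball fun y hy => ?_
    rw [← ENNReal.ofReal_mul (by positivity)]
    refine ENNReal.ofReal_le_ofReal ?_
    rw [mem_ball, dist_eq_norm] at hy
    have h2 : ‖y - y₀‖ ≤ ‖y - w i‖ + ‖w i - y₀‖ := norm_sub_le_norm_sub_add_norm_sub _ _ _
    have h3 : ‖w i - y₀‖ ≤ ‖w i - y‖ + ‖y - y₀‖ := norm_sub_le_norm_sub_add_norm_sub _ _ _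
    rw [norm_sub_rev (w i) y] at h3
    have h4 := hsl i hi
    have h5 := hwl i hi
    have h6 : 0 < ‖y - y₀‖ := by linarith
    rw [← div_eq_mul_inv, ← one_div, div_le_div_iff₀ (by positivity) (by positivity), one_mul,
      ← mul_pow]
    gcongr
    linarith
  have hsum := sum_setLIntegral_le_of_coloring μ I col (fun i => ball (w i) (s i))
    (fun i _ => measurableSet_ball) hdisj
    (Ω := (fun y => ‖y - y₀‖) ⁻¹' Set.Icc (l / 4) (4 * L)) (by
      intro i hi y hy
      rw [mem_ball, dist_eq_norm] at hy
      have h2 : ‖y - y₀‖ ≤ ‖y - w i‖ + ‖w i - y₀‖ := norm_sub_le_norm_sub_add_norm_sub _ _ _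
      have h3 : ‖w i - y₀‖ ≤ ‖w i - y‖ + ‖y - y₀‖ := norm_sub_le_norm_sub_add_norm_sub _ _ _
      rw [norm_sub_rev (w i) y] at h3
      have h4 := hsl i hi
      have h5 := hwl i hi
      have h6 := hwL i hi
      exact ⟨by linarith, by linarith⟩)
    (fun y => ENNReal.ofReal (2 ^ d) * ENNReal.ofReal ((‖y - y₀‖ ^ d)⁻¹))
  rw [lintegral_const_mul' _ _ ENNReal.ofReal_ne_top] at hsum
  have hann := setLIntegral_annulus_le μ y₀ (a := l / 4) (b := 4 * L) (by positivity) (by linarith)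
  rw [show 4 * L / (l / 4) = 16 * (L / l) by field_simp; norm_num] at hann
  have htot : ENNReal.ofReal (∑ i ∈ I, (s i / ‖w i - y₀‖) ^ d) * μ (ball 0 1) ≤
      ENNReal.ofReal (N * 2 ^ d * d * Real.log (16 * (L / l))) * μ (ball 0 1) := by
    rw [ENNReal.ofReal_sum_of_nonneg (fun i hi => by
      have := hw0 i hi; have := hs i hi; positivity), Finset.sum_mul]
    refine (Finset.sum_le_sum key).trans (hsum.trans ?_)
    refine (mul_le_mul_right (mul_le_mul_right hann _) _).trans (le_of_eq ?_)
    rw [← mul_assoc, ← mul_assoc, ← ENNReal.ofReal_natCast N, ← ENNReal.ofReal_mul (by positivity),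
      ← ENNReal.ofReal_mul (by positivity)]
    congr 2
    ring
  exact (ENNReal.ofReal_le_ofReal_iff (by positivity)).1
    ((ENNReal.mul_le_mul_iff_left hμ0 hμt).1 htot)

/-- The logarithm truncated to `[log l, log L]` is Lipschitz at scale `s`. -/
theorem abs_log_clamp_sub_le {l L s a b Λ : ℝ} (hl : 0 < l) (hs : 0 < s)
    (hsL : s ≤ 2 * L) (ha : |a - s| ≤ Λ) (hb : |b - s| ≤ Λ) (hΛ : Λ ≤ s / 2) :
    |Real.log (max l (min L a)) - Real.log (max l (min L b))| ≤ 4 * Λ / s := by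
  have main : ∀ {a b : ℝ}, |a - s| ≤ Λ → |b - s| ≤ Λ →
      Real.log (max l (min L a)) - Real.log (max l (min L b)) ≤ 4 * Λ / s := by
    intro a b ha hb
    rw [abs_le] at ha hb
    have hbs : s / 2 ≤ max l (min L b) :=
      le_max_of_le_right (le_min (by linarith) (by linarith))
    have hpa : 0 < max l (min L a) := lt_max_of_lt_left hl
    have hpb : 0 < max l (min L b) := lt_max_of_lt_left hl
    have hdiff : max l (min L a) - max l (min L b) ≤ 2 * Λ := by
      have h1 : |max l (min L a) - max l (min L b)| ≤ |a - b| := by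
        refine (abs_max_sub_max_le_max l (min L a) l (min L b)).trans ?_
        rw [sub_self, abs_zero, max_eq_right (abs_nonneg _)]
        refine (abs_min_sub_min_le_max L a L b).trans ?_
        rw [sub_self, abs_zero, max_eq_right (abs_nonneg _)]
      refine (le_abs_self _).trans (h1.trans (abs_le.2 ⟨by linarith, by linarith⟩))
    rw [← Real.log_div hpa.ne' hpb.ne']
    refine (Real.log_le_sub_one_of_pos (by positivity)).trans ?_
    rw [div_sub_one hpb.ne', div_le_div_iff₀ hpb hs]
    have hΛ0 : 0 ≤ Λ := by linarith
    nlinarith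
  rw [abs_le]
  exact ⟨by linarith [main hb ha], main ha hb⟩

section LocalEstimate

variable {E : Type*} [NormedAddCommGroup E] [NormedSpace ℝ E]

/-- The eccentricity of the images of arbitrarily small balls is bounded by `K`. -/
def OpenPartialHomeomorph.HasBoundedDilatation (e : OpenPartialHomeomorph E E) (K : ℝ) : Prop :=
  ∀ x ∈ e.source, ∀ δ > 0, ∃ r ∈ Set.Ioo 0 δ, ∃ s > 0,
    (∀ y ∈ e.source, dist x y ≤ r → dist (e x) (e y) ≤ K * s) ∧
      ∀ y ∈ e.source, r ≤ dist x y → s ≤ dist (e x) (e y)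

theorem OpenPartialHomeomorph.HasBoundedDilatation.exists_small [Nontrivial E]
    {e : OpenPartialHomeomorph E E} {K : ℝ} (he : e.HasBoundedDilatation K) {x : E}
    (hx : x ∈ e.source) {R : ℝ} (hR : 0 < R) {ε : ℝ} (hε : 0 < ε) :
    ∃ r s : ℝ, 0 < r ∧ r ≤ R ∧ 0 < s ∧ s ≤ ε ∧
      (∀ y ∈ e.source, dist x y ≤ r → dist (e x) (e y) ≤ K * s) ∧
      ∀ y ∈ e.source, r ≤ dist x y → s ≤ dist (e x) (e y) := by
  obtain ⟨ρ, hρ, hρs⟩ := Metric.isOpen_iff.1 e.open_source x hx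
  obtain ⟨δ, hδ, hcont⟩ := Metric.continuousAt_iff.1 (e.continuousAt hx) ε hε
  obtain ⟨r, ⟨hr0, hr⟩, s, hs, h1, h2⟩ := he x hx (min R (min ρ δ)) (by positivity)
  rw [lt_min_iff, lt_min_iff] at hr
  obtain ⟨v, hv⟩ := exists_norm_eq E hr0.le
  have hdv : dist (x + v) x = r := by simp [hv]
  refine ⟨r, s, hr0, hr.1.le, hs, ?_, h1, h2⟩
  have h3 := h2 (x + v) (hρs (by rw [mem_ball, hdv]; exact hr.2.1)) (by rw [dist_comm, hdv])
  rw [dist_comm] at h3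
  exact h3.trans (hcont (by rw [hdv]; exact hr.2.2)).le

theorem OpenPartialHomeomorph.log_pow_le_of_hasBoundedDilatation [FiniteDimensional ℝ E]
    [MeasurableSpace E] [BorelSpace E] (hd : 2 ≤ finrank ℝ E) {K : ℝ} (hK : 1 ≤ K) :
    ∃ M : ℝ, 0 ≤ M ∧ ∀ e : OpenPartialHomeomorph E E, e.HasBoundedDilatation K →
      ∀ (x a b : E) (R : ℝ), 0 < R → closedBall x (3 * R) ⊆ e.source → dist a x ≤ R →
        b ∈ e.source → R ≤ dist b x → dist (e b) (e x) < dist (e a) (e x) →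
        Real.log (dist (e a) (e x) / dist (e b) (e x)) ^ finrank ℝ E ≤
          M * Real.log (16 * (dist (e a) (e x) / dist (e b) (e x))) := by
  have : Nontrivial E := nontrivial_of_finrank_pos (R := ℝ) (by omega)
  have : ProperSpace E := FiniteDimensional.proper ℝ E
  obtain ⟨N, hN⟩ := HasBesicovitchCovering.exists_finset_coloring E
  set d := finrank ℝ E with hdd
  set M₁ : ℝ := (4 * 12 ^ d) ^ d * 2 ^ (d - 1) * (N * (2 * d * (d - 1))) ^ (d - 1) * 40 with hM₁
  have hM₁0 : 0 ≤ M₁ := by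
    have : (0 : ℝ) ≤ d - 1 := by
      have : (2 : ℝ) ≤ d := by exact_mod_cast hd
      linarith
    positivity
  refine ⟨M₁ * ((4 * K) ^ d * (N * 2 ^ d * d)), by positivity, ?_⟩
  intro e he x a b R hR hsrc ha hb hbR hba
  set y₀ := e x with hy₀
  set l := dist (e b) y₀ with hl
  set L := dist (e a) y₀ with hL
  have hsub2 : closedBall x (2 * R) ⊆ e.source :=
    (closedBall_subset_closedBall (by linarith)).trans hsrc
  have hxs : x ∈ e.source := hsrc (mem_closedBall_self (by positivity))
  have hl0 : 0 < l := dist_pos.2 fun h => by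
    rw [e.injOn hb hxs h, dist_self] at hbR
    linarith
  have hL0 : 0 < L := hl0.trans hba
  set ℓ := Real.log (L / l) with hℓ
  have hℓ0 : 0 < ℓ := Real.log_pos ((one_lt_div hl0).2 hba)
  have hsub : ∀ i : closedBall x (2 * R), (i : E) ∈ e.source := fun i => hsub2 i.2
  choose r s hr0 hrR hs0 hsε hup hlow using fun i : closedBall x (2 * R) =>
    he.exists_small (hsub i) hR (ε := l / (4 * K)) (by positivity)
  have hKs : ∀ i, K * s i ≤ l / 4 := fun i => by
    have := mul_le_mul_of_nonneg_left (hsε i) (zero_le_one.trans hK)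
    rwa [show K * (l / (4 * K)) = l / 4 by field_simp] at this
  have hsK : ∀ i, s i ≤ K * s i := fun i => le_mul_of_one_le_left (hs0 i).le hK
  obtain ⟨I, col, hcov, hdisj⟩ := hN _ (isCompact_closedBall x (2 * R)) r hr0 R hrR
  have hball : ∀ i : closedBall x (2 * R), closedBall (i : E) (r i) ⊆ e.source := fun i =>
    (closedBall_subset_closedBall' (by
      have h1 := mem_closedBall.1 i.2
      have h2 := hrR i
      linarith)).trans hsrc
  have himg : ∀ i : closedBall x (2 * R), ball (e i) (s i) ⊆ e '' ball (i : E) (r i) := fun i =>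
    e.ball_subset_image_ball (hr0 i) (hball i) (hs0 i) (hlow i)
  have himgdisj : ∀ i ∈ I, ∀ j ∈ I, i ≠ j → col i = col j →
      Disjoint (ball (e i) (s i)) (ball (e j) (s j)) := by
    intro i hi j hj hij hc
    refine Set.disjoint_left.2 fun z hz hz' => ?_
    obtain ⟨p, hp, rfl⟩ := himg i hz
    obtain ⟨q, hq, hqp⟩ := himg j hz'
    have := e.injOn (hball j (ball_subset_closedBall hq)) (hball i (ball_subset_closedBall hp)) hqp
    rw [this] at hq
    exact Set.disjoint_left.1 (hdisj i hi j hj hij hc) hp hq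
  set v : closedBall x (2 * R) → ℝ := fun i => ‖e i - y₀‖ with hv
  set good : closedBall x (2 * R) → Prop := fun i => l / 2 ≤ v i ∧ v i ≤ 2 * L with hgood
  classical
  set o : closedBall x (2 * R) → ℝ := fun i => if good i then 4 * (K * s i) / v i / ℓ else 0 with ho
  have ho0 : ∀ i, 0 ≤ o i := fun i => by
    have := hs0 i
    have := norm_nonneg (e i - y₀)
    simp only [ho]
    split_ifs <;> positivity
  set φ : ℝ → ℝ := fun t => (Real.log (max l (min L t)) - Real.log l) / ℓ with hφ
  have hφ0 : ∀ t ≤ l, φ t = 0 := fun t ht => by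
    simp only [hφ, max_eq_left ((min_le_right L t).trans ht), sub_self, zero_div]
  have hφ1 : ∀ t, L ≤ t → φ t = 1 := fun t ht => by
    simp only [hφ, min_eq_left ht, max_eq_right hba.le]
    rw [← Real.log_div hL0.ne' hl0.ne', div_self hℓ0.ne']
  have hφc : Continuous φ := by
    refine Continuous.div_const (Continuous.sub (Continuous.log (by fun_prop) fun t => ?_)
      continuous_const) _
    exact (lt_max_of_lt_left hl0).ne'
  have hu : ContinuousOn (fun p => φ ‖e p - y₀‖) (closedBall x (2 * R)) :=
    hφc.comp_continuousOn ((e.continuousOn.mono hsub2).sub continuousOn_const).norm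
  have key := one_le_sum_osc_pow (Measure.addHaar : Measure E) hd x hR hu I col
    (fun i => (i : E)) r hr0 (fun i _ => hrR i) (fun i _ => i.2) o ho0 hdisj hcov ?_ ?_ ?_
  · have hsum : ∑ i ∈ I, o i ^ d = (4 * K / ℓ) ^ d *
        ∑ i ∈ I with good i, (s i / v i) ^ d := by
      rw [Finset.mul_sum, Finset.sum_filter]
      refine Finset.sum_congr rfl fun i _ => ?_
      simp only [ho]
      split_ifs
      · rw [← mul_pow]
        congr 1
        ring
      · exact zero_pow (by omega)
    have hen := sum_div_pow_le_log (Measure.addHaar : Measure E) (I.filter good) col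
      (fun i => e i) s (fun i _ => hs0 i) y₀ hl0 hba.le
      (fun i _ => (hsK i).trans (hKs i)) (fun i hi => (Finset.mem_filter.1 hi).2.1)
      (fun i hi => (Finset.mem_filter.1 hi).2.2)
      (fun i hi j hj => himgdisj i (Finset.mem_filter.1 hi).1 j (Finset.mem_filter.1 hj).1)
    rw [hsum] at key
    have h2 : 1 ≤ M₁ * ((4 * K / ℓ) ^ d * (N * 2 ^ d * d * Real.log (16 * (L / l)))) :=
      key.trans (by gcongr)
    rw [div_pow] at h2
    have h3 := mul_le_mul_of_nonneg_left h2 (pow_nonneg hℓ0.le d)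
    rw [mul_one] at h3
    refine h3.trans (le_of_eq ?_)
    have : ℓ ^ d ≠ 0 := (pow_pos hℓ0 d).ne'
    field_simp
  · intro i hi p hp q hq
    have hest : ∀ p ∈ closedBall x (2 * R) ∩ ball (i : E) (r i), |‖e p - y₀‖ - v i| ≤ K * s i := by
      intro p hp
      have h1 := hup i p (hsub2 hp.1) (mem_ball'.1 hp.2).le
      refine (abs_norm_sub_norm_le _ _).trans ?_
      rw [sub_sub_sub_cancel_right, ← dist_eq_norm, dist_comm]
      exact h1
    have hp' := hest p hp
    have hq' := hest q hq
    have hKs' := hKs i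
    simp only [ho]
    split_ifs with hg
    · have hvi : 0 < v i := by linarith [hg.1]
      have h1 := abs_log_clamp_sub_le hl0 hvi hg.2 hp' hq' (by linarith [hg.1])
      simp only [hφ]
      rw [← sub_div, sub_sub_sub_cancel_right, abs_div, abs_of_pos hℓ0]
      gcongr
    · rw [abs_le] at hp' hq'
      rcases not_and_or.1 hg with h | h
      · rw [hφ0 _ (by linarith), hφ0 _ (by linarith), sub_self, abs_zero]
      · rw [hφ1 _ (by linarith), hφ1 _ (by linarith), sub_self, abs_zero]
  · intro t ht
    obtain ⟨p, hp, hpl⟩ := e.exists_dist_eq_dist_image_le ht.1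
      ((closedBall_subset_closedBall (by linarith [ht.2])).trans hsrc) hb (ht.2.trans hbR)
    exact ⟨p, by rw [← dist_eq_norm, hp], hφ0 _ (by rw [← dist_eq_norm]; exact hpl)⟩
  · intro t ht
    obtain ⟨q, hq, hqL⟩ := e.exists_dist_eq_le_dist_image (t := R + t)
      ((closedBall_subset_closedBall (by linarith [ht.2])).trans hsrc) (dist_pos.1 hL0)
      (by linarith [ht.1])
    exact ⟨q, by rw [← dist_eq_norm, hq], hφ1 _ (by rw [← dist_eq_norm]; exact hqL)⟩

/-- Local weak quasisymmetry: the oscillation of `e` on a ball is controlled by the displacement of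
the points outside of that ball. -/
theorem OpenPartialHomeomorph.exists_dist_image_le_mul [FiniteDimensional ℝ E]
    [MeasurableSpace E] [BorelSpace E] (hd : 2 ≤ finrank ℝ E) {K : ℝ} (hK : 1 ≤ K) :
    ∃ C : ℝ, 1 ≤ C ∧ ∀ e : OpenPartialHomeomorph E E, e.HasBoundedDilatation K →
      ∀ (x a b : E) (R : ℝ), 0 < R → closedBall x (3 * R) ⊆ e.source → dist a x ≤ R →
        b ∈ e.source → R ≤ dist b x → dist (e a) (e x) ≤ C * dist (e b) (e x) := by
  obtain ⟨M, hM0, hM⟩ := log_pow_le_of_hasBoundedDilatation hd hK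
  refine ⟨Real.exp (2 * M + Real.log 16), Real.one_le_exp (by
    have := Real.log_nonneg (show (1 : ℝ) ≤ 16 by norm_num)
    positivity), ?_⟩
  intro e he x a b R hR hsrc ha hb hbR
  have hxs : x ∈ e.source := hsrc (mem_closedBall_self (by positivity))
  have hl0 : 0 < dist (e b) (e x) := dist_pos.2 fun h => by
    rw [e.injOn hb hxs h, dist_self] at hbR
    linarith
  by_contra! hlt
  rw [← lt_div_iff₀ hl0] at hlt
  have h16 : 1 ≤ Real.log 16 := by
    rw [Real.le_log_iff_exp_le (by norm_num)]
    linarith [Real.exp_one_lt_d9]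
  have hT0 : 0 < dist (e a) (e x) / dist (e b) (e x) := (Real.exp_pos _).trans hlt
  have hT1 : 1 < dist (e a) (e x) / dist (e b) (e x) :=
    (Real.one_le_exp (by positivity)).trans_lt hlt
  have h1 := hM e he x a b R hR hsrc ha hb hbR ((one_lt_div hl0).1 hT1)
  rw [Real.log_mul (by norm_num) hT0.ne'] at h1
  rw [← Real.lt_log_iff_exp_lt hT0] at hlt
  set ℓ := Real.log (dist (e a) (e x) / dist (e b) (e x))
  have hℓ : 1 ≤ ℓ := by linarith
  have h2 : ℓ ^ 2 ≤ ℓ ^ finrank ℝ E := pow_le_pow_right₀ hℓ hd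
  nlinarith

end LocalEstimate

/-- Ratios that stay bounded for bounded parameters and are small for small parameters are dominated
by a distortion function of the parameter. -/
theorem exists_isDistortion_of_ratio_bounds {ι : Type*} (t q : ι → ℝ) (ht : ∀ i, 0 ≤ t i)
    (hbdd : ∀ M, ∃ K, ∀ i, t i ≤ M → q i ≤ K)
    (hsmall : ∀ ε > 0, ∃ δ > 0, ∀ i, t i ≤ δ → q i ≤ ε) :
    ∃ η : ℝ → ℝ, IsDistortion η ∧ ∀ i, q i ≤ η (t i) := by
  set S : ℝ → Set ℝ := fun s => insert 0 (q '' {i | t i ≤ s}) with hS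
  set Φ : ℝ → ℝ := fun s => sSup (S s) with hΦ
  have hbddS : ∀ s, BddAbove (S s) := fun s => by
    obtain ⟨K, hK⟩ := hbdd s
    refine (?_ : BddAbove (q '' {i | t i ≤ s})).insert 0
    exact ⟨K, Set.forall_mem_image.2 fun i hi => hK i hi⟩
  have hΦ0 : ∀ s, 0 ≤ Φ s := fun s => le_csSup (hbddS s) (Set.mem_insert _ _)
  have hΦle : ∀ s K, 0 ≤ K → (∀ i, t i ≤ s → q i ≤ K) → Φ s ≤ K := fun s K hK h =>
    csSup_le ⟨0, Set.mem_insert _ _⟩ (Set.forall_mem_insert.2 ⟨hK, Set.forall_mem_image.2 h⟩)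
  have hqΦ : ∀ i, q i ≤ Φ (t i) := fun i =>
    le_csSup (hbddS _) (Set.mem_insert_of_mem _ ⟨i, le_refl (t i), rfl⟩)
  have hmono : Monotone Φ := fun a b hab => csSup_le_csSup (hbddS b) ⟨0, Set.mem_insert _ _⟩
    (Set.insert_subset_insert (Set.image_mono fun i (hi : t i ≤ a) => hi.trans hab))
  have hΦz : Φ 0 = 0 := le_antisymm (le_of_forall_pos_le_add fun ε hε => by
    obtain ⟨δ, hδ, h⟩ := hsmall ε hε
    rw [zero_add]
    exact hΦle 0 ε hε.le fun i hi => h i (hi.trans hδ.le)) (hΦ0 0)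
  have hΦc : ContinuousAt Φ 0 := by
    rw [Metric.continuousAt_iff]
    intro ε hε
    obtain ⟨δ, hδ, h⟩ := hsmall (ε / 2) (by positivity)
    refine ⟨δ, hδ, fun {s} hs => ?_⟩
    rw [Real.dist_0_eq_abs] at hs
    rw [hΦz, Real.dist_0_eq_abs, abs_of_nonneg (hΦ0 s)]
    have := hΦle s (ε / 2) (by positivity) fun i hi => h i (hi.trans ((le_abs_self s).trans hs.le))
    linarith
  have hfint : ∀ s, IntervalIntegrable (fun w => Φ (s * w)) volume 1 2 := fun s => by
    rcases le_total 0 s with hs | hs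
    · exact (hmono.comp (monotone_mul_left_of_nonneg hs)).intervalIntegrable
    · exact (hmono.comp_antitone (antitone_mul_left hs)).intervalIntegrable
  have hJmono : ∀ a b, 0 ≤ a → a ≤ b → ∫ w in (1 : ℝ)..2, Φ (a * w) ≤ ∫ w in (1 : ℝ)..2, Φ (b * w) :=
    fun a b ha hab => intervalIntegral.integral_mono_on (by norm_num) (hfint a) (hfint b)
      fun w hw => hmono (mul_le_mul_of_nonneg_right hab (by linarith [hw.1]))
  have hJge : ∀ a, 0 ≤ a → Φ a ≤ ∫ w in (1 : ℝ)..2, Φ (a * w) := fun a ha => by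
    have h1 := intervalIntegral.integral_mono_on (f := fun _ => Φ a) (by norm_num)
      (intervalIntegrable_const (μ := volume)) (hfint a)
      fun w hw => hmono (le_mul_of_one_le_right ha hw.1)
    rw [intervalIntegral.integral_const, show (2 : ℝ) - 1 = 1 by norm_num, one_smul] at h1
    exact h1
  have hJcont : Continuous fun a => ∫ w in (1 : ℝ)..2, Φ (a * w) := by
    rw [continuous_iff_continuousAt]
    intro a
    refine intervalIntegral.continuousAt_of_dominated_interval
      (bound := fun _ => Φ ((|a| + 1) * 2)) ?_ ?_ intervalIntegrable_const ?_
    · exact Filter.Eventually.of_forall fun s =>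
        (hmono.measurable.comp (measurable_const_mul s)).aestronglyMeasurable
    · filter_upwards [Metric.ball_mem_nhds a one_pos] with s hs
      refine Filter.Eventually.of_forall fun w hw => ?_
      rw [Set.uIoc_of_le (by norm_num)] at hw
      rw [Real.norm_of_nonneg (hΦ0 _)]
      rw [Metric.mem_ball, Real.dist_eq] at hs
      have h1 : |s| ≤ |a| + 1 := by
        have := abs_sub_abs_le_abs_sub s a
        linarith
      refine hmono ((le_abs_self _).trans ?_)
      rw [abs_mul, abs_of_pos (show 0 < w by linarith [hw.1])]
      exact mul_le_mul h1 hw.2 (by linarith [hw.1]) (by positivity)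
    · rcases eq_or_ne a 0 with rfl | ha
      · refine Filter.Eventually.of_forall fun w _ => ?_
        have h0 : ContinuousAt Φ (0 * w) := by rwa [zero_mul]
        exact ContinuousAt.comp (f := fun s => s * w) h0 (by fun_prop)
      · have hcount : ((fun w => a * w) ⁻¹' {s | ¬ContinuousAt Φ s}).Countable :=
          hmono.countable_not_continuousAt.preimage (mul_right_injective₀ ha)
        filter_upwards [hcount.ae_notMem volume] with w hw _
        have h0 : ContinuousAt Φ (a * w) := by
          by_contra h
          exact hw h
        exact ContinuousAt.comp (f := fun s => s * w) h0 (by fun_prop)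
  refine ⟨fun s => s + ∫ w in (1 : ℝ)..2, Φ (s * w), ⟨?_, ?_, ?_, ?_, ?_⟩, fun i => ?_⟩
  · exact (continuous_id.add hJcont).continuousOn
  · intro a ha b _ hab
    exact add_le_add hab (hJmono a b ha hab)
  · intro s hs
    exact add_nonneg hs ((hΦ0 s).trans (hJge s hs))
  · simp [hΦz]
  · refine Filter.tendsto_atTop_mono' _ ?_ Filter.tendsto_id
    filter_upwards [Filter.eventually_ge_atTop 0] with s hs
    exact le_add_of_nonneg_right ((hΦ0 s).trans (hJge s hs))
  · exact (hqΦ i).trans ((hJge _ (ht i)).trans (le_add_of_nonneg_left (ht i)))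

section Globalization

/-- A bounded set contains only boundedly many uniformly separated points. -/
theorem exists_nat_forall_exists_dist_lt_one (E : Type*) [NormedAddCommGroup E]
    [NormedSpace ℝ E] [FiniteDimensional ℝ E] (Q : ℝ) :
    ∃ n : ℕ, ∀ p : ℕ → E, (∀ i ≤ n, ‖p i‖ ≤ Q) → ∃ i j, i < j ∧ j ≤ n ∧ dist (p i) (p j) < 1 := by
  have : ProperSpace E := FiniteDimensional.proper ℝ E
  obtain ⟨T, hT, hcov⟩ := Metric.totallyBounded_iff.1
    (isCompact_closedBall (0 : E) Q).totallyBounded (1 / 2) (by norm_num)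
  refine ⟨hT.toFinset.card, fun p hp => ?_⟩
  have hex : ∀ i : ℕ, ∃ y, i ≤ hT.toFinset.card → y ∈ T ∧ p i ∈ ball y (1 / 2) := by
    intro i
    by_cases hi : i ≤ hT.toFinset.card
    · have := hcov (mem_closedBall_zero_iff.2 (hp i hi))
      simp only [Set.mem_iUnion] at this
      obtain ⟨y, hy, hpy⟩ := this
      exact ⟨y, fun _ => ⟨hy, hpy⟩⟩
    · exact ⟨0, fun h => absurd h hi⟩
  choose y hy using hex
  obtain ⟨i, hi, j, hj, hij, hyij⟩ := Finset.exists_ne_map_eq_of_card_lt_of_maps_to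
    (s := Finset.range (hT.toFinset.card + 1)) (t := hT.toFinset) (f := y) (by simp)
    (fun i hi => by
      simp only [Finset.coe_range, Set.mem_Iio, Nat.lt_succ_iff] at hi
      simpa using (hy i hi).1)
  rw [Finset.mem_range, Nat.lt_succ_iff] at hi hj
  have hdist : dist (p i) (p j) < 1 := by
    have h1 := mem_ball.1 (hy i hi).2
    have h2 := mem_ball.1 (hy j hj).2
    rw [← hyij] at h2
    linarith [dist_triangle_right (p i) (p j) (y i)]
  rcases lt_or_gt_of_ne hij with h | h
  · exact ⟨i, j, h, hj, hdist⟩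
  · exact ⟨j, i, h, hi, by rwa [dist_comm]⟩

variable {E : Type*} [NormedAddCommGroup E] [NormedSpace ℝ E]

/-- Weak quasisymmetry of `e` on the balls compactly contained in its source. -/
def OpenPartialHomeomorph.IsLocallyWeaklyQuasisymmetric (e : OpenPartialHomeomorph E E) (C : ℝ) :
    Prop :=
  ∀ (x a b : E) (R : ℝ), 0 < R → closedBall x (3 * R) ⊆ e.source → dist a x ≤ R →
    b ∈ e.source → R ≤ dist b x → dist (e a) (e x) ≤ C * dist (e b) (e x)

theorem OpenPartialHomeomorph.IsLocallyWeaklyQuasisymmetric.dist_le_of_le_nat_mul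
    {e : OpenPartialHomeomorph E E} {C : ℝ} (he : e.IsLocallyWeaklyQuasisymmetric C) (hC : 1 ≤ C)
    {k : ℕ} (hk : 0 < k) {x y z : E} (hball : closedBall x (4 * dist y x) ⊆ e.source)
    (hz : z ∈ e.source) (hyz : dist y x ≤ k * dist z x) :
    dist (e y) (e x) ≤ k * C ^ k * dist (e z) (e x) := by
  have hk' : (0 : ℝ) < k := by exact_mod_cast hk
  have hk1 : (1 : ℝ) ≤ k := by exact_mod_cast hk
  rcases eq_or_ne y x with rfl | hxy
  · rw [dist_self]
    positivity
  have hpos : 0 < dist y x := dist_pos.2 hxy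
  set h := dist y x / k with hh
  have hh0 : 0 < h := by positivity
  have hhle : h ≤ dist y x := div_le_self hpos.le hk1
  set p : ℕ → E := fun i => x + ((i : ℝ) / k) • (y - x) with hp
  have hstep : ∀ i, dist (p (i + 1)) (p i) = h := fun i => by
    simp only [hp]
    rw [dist_add_left, dist_eq_norm, ← sub_smul, norm_smul, Nat.cast_succ, ← sub_div,
      add_sub_cancel_left, Real.norm_of_nonneg (by positivity), hh, dist_eq_norm]
    ring
  have hpx : ∀ i ≤ k, dist (p i) x ≤ dist y x := fun i hi => by
    simp only [hp]
    rw [dist_eq_norm, add_sub_cancel_left, norm_smul, Real.norm_of_nonneg (by positivity),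
      dist_eq_norm]
    refine mul_le_of_le_one_left (norm_nonneg _) ((div_le_one hk').2 ?_)
    exact_mod_cast hi
  have hp0 : p 0 = x := by simp [hp]
  have hpk : p k = y := by simp [hp, hk'.ne']
  have hbi : ∀ i ≤ k, closedBall (p i) (3 * h) ⊆ e.source := fun i hi =>
    (closedBall_subset_closedBall' (by linarith [hpx i hi])).trans hball
  have hgrow : ∀ i < k, dist (e (p (i + 1))) (e (p i)) ≤ C ^ (i + 1) * dist (e z) (e x) := by
    intro i
    induction i with
    | zero =>
      intro _
      have h1 := he (p 0) (p 1) z h hh0 (hbi 0 (Nat.zero_le _)) (hstep 0).le hz (by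
        rw [hp0, hh, div_le_iff₀ hk']
        linarith)
      rw [zero_add, pow_one]
      rwa [hp0] at h1 ⊢
    | succ i ih =>
      intro hi
      have h1 := he (p (i + 1)) (p (i + 1 + 1)) (p i) h hh0 (hbi _ hi.le) (hstep _).le
        (hbi i (by omega) (mem_closedBall_self (by positivity))) (by rw [dist_comm, hstep])
      rw [dist_comm (e (p i))] at h1
      refine h1.trans ?_
      rw [pow_succ' C (i + 1), mul_assoc]
      exact mul_le_mul_of_nonneg_left (ih (by omega)) (by linarith)
  have hsum := dist_le_range_sum_of_dist_le (f := fun i => e (p i)) k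
    (d := fun _ => C ^ k * dist (e z) (e x)) (fun {i} hi => by
      rw [dist_comm]
      refine (hgrow i hi).trans ?_
      gcongr
      omega)
  simp only [hp0, hpk, Finset.sum_const, Finset.card_range, nsmul_eq_mul] at hsum
  rw [dist_comm, mul_assoc]
  exact hsum

theorem OpenPartialHomeomorph.IsLocallyWeaklyQuasisymmetric.exists_forall_dist_le
    [FiniteDimensional ℝ E] {e : OpenPartialHomeomorph E E} {C : ℝ}
    (he : e.IsLocallyWeaklyQuasisymmetric C) (hC : 1 ≤ C) {ε : ℝ} (hε : 0 < ε) :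
    ∃ δ : ℝ, 0 < δ ∧ δ ≤ 1 ∧ ∀ x y z : E, closedBall x (4 * dist z x) ⊆ e.source →
      dist y x ≤ δ * dist z x → dist (e y) (e x) ≤ ε * dist (e z) (e x) := by
  obtain ⟨n, hn⟩ := exists_nat_forall_exists_dist_lt_one E (C ^ 3 / ε)
  refine ⟨(1 / 3) ^ n, by positivity, pow_le_one₀ (by norm_num) (by norm_num), ?_⟩
  intro x y z hball hyz
  by_contra! hlt
  have hyx : 0 < dist (e y) (e x) := lt_of_le_of_lt (by positivity) hlt
  have ht : 0 < dist y x := dist_pos.2 fun h => by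
    rw [h, dist_self] at hyx
    exact hyx.false
  have hs : 0 < dist z x := by
    by_contra h
    rw [le_antisymm (not_lt.1 h) dist_nonneg, mul_zero] at hyz
    linarith
  set p : ℕ → E := fun i => x + ((1 / 3 : ℝ) ^ i) • (z - x) with hp
  have hpx : ∀ i, dist (p i) x = (1 / 3 : ℝ) ^ i * dist z x := fun i => by
    simp only [hp]
    rw [dist_eq_norm, add_sub_cancel_left, norm_smul, Real.norm_of_nonneg (by positivity),
      dist_eq_norm]
  have hpz : ∀ i, dist (p i) x ≤ dist z x := fun i => by
    rw [hpx]
    exact mul_le_of_le_one_left hs.le (pow_le_one₀ (by norm_num) (by norm_num))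
  have hpsrc : ∀ i, p i ∈ e.source := fun i =>
    hball (mem_closedBall.2 ((hpz i).trans (by linarith)))
  have hxsrc : x ∈ e.source := hball (mem_closedBall_self (by positivity))
  have hzsrc : z ∈ e.source := hball (mem_closedBall.2 (by linarith))
  have hyp : ∀ i ≤ n, dist y x ≤ dist (p i) x := fun i hi => by
    rw [hpx]
    refine hyz.trans (mul_le_mul_of_nonneg_right ?_ hs.le)
    exact pow_le_pow_of_le_one (by norm_num) (by norm_num) hi
  have hupper : ∀ i, dist (e (p i)) (e x) ≤ C * dist (e z) (e x) := fun i =>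
    he x (p i) z (dist z x) hs ((closedBall_subset_closedBall (by linarith)).trans hball)
      (hpz i) hzsrc le_rfl
  have hsep : ∀ i j, i < j → j ≤ n → dist (e y) (e x) ≤ C ^ 2 * dist (e (p i)) (e (p j)) := by
    intro i j hij hj
    have h1 := he x y (p j) (dist y x) ht
      ((closedBall_subset_closedBall (by linarith [hyp j hj, hpz j])).trans hball) le_rfl
      (hpsrc j) (hyp j hj)
    have hpj : 0 < dist (p j) x := ht.trans_le (hyp j hj)
    have h2 := he (p j) x (p i) (dist (p j) x) hpj
      ((closedBall_subset_closedBall' (by linarith [hpz j])).trans hball) (by rw [dist_comm])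
      (hpsrc i) (by
        have h3 : dist (p i) x ≤ dist (p i) (p j) + dist (p j) x := dist_triangle _ _ _
        have h4 : 3 * dist (p j) x ≤ dist (p i) x := by
          obtain ⟨k, rfl⟩ := Nat.exists_eq_add_of_lt hij
          rw [hpx, hpx, pow_succ, pow_add]
          have h5 : ((1 : ℝ) / 3) ^ k ≤ 1 := pow_le_one₀ (by norm_num) (by norm_num)
          have h6 : 0 ≤ ((1 : ℝ) / 3) ^ i * dist z x := by positivity
          nlinarith
        linarith)
    rw [dist_comm (e x)] at h2
    refine h1.trans ?_
    rw [pow_two, mul_assoc]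
    exact mul_le_mul_of_nonneg_left h2 (by linarith)
  set σ := dist (e y) (e x) / C ^ 2 with hσ
  have hσ0 : 0 < σ := by positivity
  obtain ⟨i, j, hij, hj, hdist⟩ := hn (fun i => σ⁻¹ • (e (p i) - e x)) fun i _ => by
    rw [norm_smul, Real.norm_of_nonneg (by positivity), ← dist_eq_norm, inv_mul_le_iff₀ hσ0]
    refine (hupper i).trans ?_
    rw [hσ, show dist (e y) (e x) / C ^ 2 * (C ^ 3 / ε) = C * (dist (e y) (e x) / ε) by
      field_simp]
    refine mul_le_mul_of_nonneg_left ?_ (by linarith)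
    rw [le_div_iff₀ hε]
    linarith
  rw [dist_smul₀, dist_sub_right, Real.norm_of_nonneg (by positivity), inv_mul_lt_iff₀ hσ0,
    mul_one, hσ, lt_div_iff₀ (by positivity)] at hdist
  linarith [hsep i j hij hj]

/-- An injective continuous map keeps far away points of a compact set uniformly apart. -/
theorem IsCompact.exists_pos_forall_le_dist_image {X Y : Type*} [MetricSpace X] [MetricSpace Y]
    {A : Set X} (hA : IsCompact A) {f : X → Y} (hf : ContinuousOn f A) (hinj : Set.InjOn f A)
    {τ : ℝ} (hτ : 0 < τ) :
    ∃ m > 0, ∀ x ∈ A, ∀ z ∈ A, τ ≤ dist z x → m ≤ dist (f z) (f x) := by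
  have hcl : IsClosed {p : X × X | τ ≤ dist p.1 p.2} := isClosed_le (by fun_prop) (by fun_prop)
  have hcont : ContinuousOn (fun p : X × X => dist (f p.1) (f p.2))
      (A ×ˢ A ∩ {p | τ ≤ dist p.1 p.2}) :=
    continuous_dist.comp_continuousOn ((hf.comp continuousOn_fst fun p hp => hp.1.1).prodMk
      (hf.comp continuousOn_snd fun p hp => hp.1.2))
  obtain ⟨m, hm, h⟩ := ((hA.prod hA).inter_right hcl).exists_forall_le' hcont (a := 0)
    (fun p hp => dist_pos.2 fun h => by
      have h1 : τ ≤ dist p.1 p.2 := hp.2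
      rw [hinj hp.1.1 hp.1.2 h, dist_self] at h1
      exact h1.not_gt hτ)
  exact ⟨m, hm, fun x hx z hz hxz => h (z, x) ⟨⟨hz, hx⟩, hxz⟩⟩

theorem OpenPartialHomeomorph.IsLocallyWeaklyQuasisymmetric.exists_isDistortion
    [FiniteDimensional ℝ E] {e : OpenPartialHomeomorph E E} {C : ℝ}
    (he : e.IsLocallyWeaklyQuasisymmetric C) (hC : 1 ≤ C) {A : Set E} (hA : IsCompact A)
    (hAs : A ⊆ e.source) :
    ∃ η : ℝ → ℝ, IsDistortion η ∧ ∀ x ∈ A, ∀ y ∈ A, ∀ z ∈ A, x ≠ z →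
      dist (e x) (e y) / dist (e x) (e z) ≤ η (dist x y / dist x z) := by
  have hec : ContinuousOn e A := e.continuousOn.mono hAs
  have hinj : Set.InjOn e A := e.injOn.mono hAs
  obtain ⟨ρ, hρ, hρs⟩ := hA.exists_cthickening_subset_open e.open_source hAs
  have hballs : ∀ x ∈ A, ∀ t ≤ ρ, closedBall x t ⊆ e.source := fun x hx t ht =>
    ((closedBall_subset_closedBall ht).trans (closedBall_subset_cthickening hx ρ)).trans hρs
  obtain ⟨D, hD⟩ := Metric.isBounded_iff.1 hA.isBounded
  obtain ⟨D', hD'⟩ := Metric.isBounded_iff.1 (hA.image_of_continuousOn hec).isBounded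
  have hbdd : ∀ M : ℝ, ∃ K, ∀ x ∈ A, ∀ y ∈ A, ∀ z ∈ A, dist y x ≤ M * dist z x →
      dist (e y) (e x) ≤ K * dist (e z) (e x) := by
    intro M
    set k := ⌈M⌉₊ + 1 with hk
    have hk0 : (0 : ℝ) < k := by positivity
    have hMk : M ≤ k := (Nat.le_ceil M).trans (by simp [hk])
    obtain ⟨m, hm, hmle⟩ := hA.exists_pos_forall_le_dist_image hec hinj
      (τ := ρ / (4 * k)) (by positivity)
    refine ⟨max (k * C ^ k) (D' / m), fun x hx y hy z hz hyz => ?_⟩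
    have hyz' : dist y x ≤ k * dist z x :=
      hyz.trans (mul_le_mul_of_nonneg_right hMk dist_nonneg)
    rcases le_total (ρ / (4 * k)) (dist z x) with h | h
    · have h1 := hmle x hx z hz h
      have h2 := hD' (Set.mem_image_of_mem e hy) (Set.mem_image_of_mem e hx)
      have hD0 : 0 ≤ D' := dist_nonneg.trans h2
      refine (?_ : _ ≤ D' / m * dist (e z) (e x)).trans
        (mul_le_mul_of_nonneg_right (le_max_right _ _) dist_nonneg)
      refine h2.trans ?_
      calc D' = D' / m * m := by field_simp
        _ ≤ D' / m * dist (e z) (e x) := by gcongr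
    · refine (he.dist_le_of_le_nat_mul hC (Nat.succ_pos _) (hballs x hx _ ?_) (hAs hz) hyz').trans
        (mul_le_mul_of_nonneg_right (le_max_left _ _) dist_nonneg)
      rw [le_div_iff₀ (by positivity)] at h
      linarith
  have hsmall : ∀ ε > 0, ∃ δ > 0, ∀ x ∈ A, ∀ y ∈ A, ∀ z ∈ A, dist y x ≤ δ * dist z x →
      dist (e y) (e x) ≤ ε * dist (e z) (e x) := by
    intro ε hε
    obtain ⟨m, hm, hmle⟩ := hA.exists_pos_forall_le_dist_image hec hinj
      (τ := ρ / 4) (by positivity)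
    obtain ⟨δ₁, hδ₁, huc⟩ := Metric.uniformContinuousOn_iff.1
      (hA.uniformContinuousOn_of_continuous hec) (ε * m) (by positivity)
    obtain ⟨δ₂, hδ₂, -, hδ₂le⟩ := he.exists_forall_dist_le hC hε
    refine ⟨min δ₂ (δ₁ / (|D| + 1)), by positivity, fun x hx y hy z hz hyz => ?_⟩
    rcases le_total (ρ / 4) (dist z x) with h | h
    · have h1 : dist y x < δ₁ := by
        have hzD : dist z x < |D| + 1 := (hD hz hx).trans_lt (by linarith [le_abs_self D])
        refine (hyz.trans (mul_le_mul_of_nonneg_right (min_le_right _ _) dist_nonneg)).trans_lt ?_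
        rw [div_mul_eq_mul_div, div_lt_iff₀ (by positivity)]
        exact mul_lt_mul_of_pos_left hzD hδ₁
      exact (huc y hy x hx h1).le.trans (mul_le_mul_of_nonneg_left (hmle x hx z hz h) hε.le)
    · exact hδ₂le x y z (hballs x hx _ (by linarith))
        (hyz.trans (mul_le_mul_of_nonneg_right (min_le_left _ _) dist_nonneg))
  obtain ⟨η, hη, hle⟩ := exists_isDistortion_of_ratio_bounds
    (ι := {p : E × E × E // p.1 ∈ A ∧ p.2.1 ∈ A ∧ p.2.2 ∈ A ∧ p.1 ≠ p.2.2})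
    (fun p => dist p.1.1 p.1.2.1 / dist p.1.1 p.1.2.2)
    (fun p => dist (e p.1.1) (e p.1.2.1) / dist (e p.1.1) (e p.1.2.2))
    (fun p => by positivity)
    (fun M => by
      obtain ⟨K, hK⟩ := hbdd M
      refine ⟨K, ?_⟩
      rintro ⟨⟨x, y, z⟩, hx, hy, hz, hxz⟩ h
      simp only [dist_comm x, dist_comm (e x)] at *
      rw [div_le_iff₀ (dist_pos.2 hxz.symm)] at h
      rw [div_le_iff₀ (dist_pos.2 fun h => hxz.symm (hinj hz hx h))]
      exact hK x hx y hy z hz h)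
    (fun ε hε => by
      obtain ⟨δ, hδ, hδle⟩ := hsmall ε hε
      refine ⟨δ, hδ, ?_⟩
      rintro ⟨⟨x, y, z⟩, hx, hy, hz, hxz⟩ h
      simp only [dist_comm x, dist_comm (e x)] at *
      rw [div_le_iff₀ (dist_pos.2 hxz.symm)] at h
      rw [div_le_iff₀ (dist_pos.2 fun h => hxz.symm (hinj hz hx h))]
      exact hδle x hx y hy z hz h)
  exact ⟨η, hη, fun x hx y hy z hz hxz => hle ⟨(x, y, z), hx, hy, hz, hxz⟩⟩

end Globalization

end Auxiliary

/-- Let `n ≥ 2`, let `U, V` be domains in `ℝⁿ`, and let `f : U → V`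
be an `H`-quasiconformal homeomorphism (with inverse `g`), i.e. its linear
dilatation satisfies `H_f(x) ≤ H` for all `x ∈ U`. Then for every compact `A ⊆ U`
the restriction `f|_A` is an `η`-quasisymmetry for some distortion function `η`. -/
theorem quasiconformal_restriction_quasisymmetric
    (n : ℕ) (hn : 2 ≤ n)
    (U V : Set (EuclideanSpace ℝ (Fin n)))
    (hUopen : IsOpen U) (hUconn : IsConnected U)
    (hVopen : IsOpen V) (hVconn : IsConnected V)
    (f g : EuclideanSpace ℝ (Fin n) → EuclideanSpace ℝ (Fin n))
    (hbij : Set.BijOn f U V)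
    (hfc : ContinuousOn f U) (hgc : ContinuousOn g V)
    (hinv : Set.InvOn g f U V)
    (H : ℝ) (hH : 1 ≤ H)
    (hqc : ∀ x ∈ U, linearDilatationOn f U x ≤ ENNReal.ofReal H)
    (A : Set (EuclideanSpace ℝ (Fin n))) (hAU : A ⊆ U) (hA : IsCompact A) :
    ∃ η : ℝ → ℝ, IsDistortion η ∧
      ∀ x ∈ A, ∀ y ∈ A, ∀ z ∈ A, x ≠ z →
        dist (f x) (f y) / dist (f x) (f z) ≤ η (dist x y / dist x z) := by
  have hn' : 2 ≤ Module.finrank ℝ (EuclideanSpace ℝ (Fin n)) := by simpa using hn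
  have : Nontrivial (EuclideanSpace ℝ (Fin n)) :=
    Module.nontrivial_of_finrank_pos (R := ℝ) (by omega)
  let e : OpenPartialHomeomorph (EuclideanSpace ℝ (Fin n)) (EuclideanSpace ℝ (Fin n)) :=
    { toFun := f
      invFun := g
      source := U
      target := V
      map_source' := fun x hx => hbij.mapsTo hx
      map_target' := fun y hy => by
        obtain ⟨x, hx, rfl⟩ := hbij.surjOn hy
        rwa [hinv.1 hx]
      left_inv' := fun x hx => hinv.1 hx
      right_inv' := fun y hy => hinv.2 hy
      open_source := hUopen
      open_target := hVopen
      continuousOn_toFun := hfc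
      continuousOn_invFun := hgc }
  have he : e.HasBoundedDilatation (H + 1) := fun x hx δ hδ =>
    exists_radius_of_linearDilatationOn_lt hUopen hbij.injOn hx
      ((hqc x hx).trans_lt ((ENNReal.ofReal_lt_ofReal_iff (by linarith)).2 (lt_add_one H))) hδ
  obtain ⟨C, hC, hCe⟩ := OpenPartialHomeomorph.exists_dist_image_le_mul
    (E := EuclideanSpace ℝ (Fin n)) hn' (show 1 ≤ H + 1 by linarith)
  exact OpenPartialHomeomorph.IsLocallyWeaklyQuasisymmetric.exists_isDistortion
    (e := e) (hCe e he) hC hA hAU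

end
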